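/- Let N ≥ 2 and p ∈ (1, p_N). If 0 ≤ λ₁ < λ₂ and (α₁, ψ₁), (α₂, ψ₂) are solutions of problem (P)_{λ₁} and (P)_{λ₂} respectively on the unit-volume ball 𝔻_N, then ∫_{𝔻_N} |∇ψ₁|² < ∫_{𝔻_N} |∇ψ₂|² (the energy E_λ = ½∫|∇ψ_λ|² of the unique solution is strictly increasing in λ). -/

import Mathlib

open MeasureTheory Metric Set

noncomputable section

/-- The Laplacian of a function on Euclidean space. -/
def lapl {N : ℕ} (f : EuclideanSpace ℝ (Fin N) → ℝ) (x : EuclideanSpace ℝ (Fin N)) : ℝ :=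
  ∑ i : Fin N,
    fderiv ℝ (fun y => fderiv ℝ f y (EuclideanSpace.single i (1 : ℝ))) x
      (EuclideanSpace.single i (1 : ℝ))

/-- `(α, ψ)` is a solution of problem `(P)_λ` on `Ω`:
`ψ ∈ C²`, `-Δψ = (max (α + λψ) 0)^p` in `Ω`, `ψ = 0` on `∂Ω`, and
`∫_Ω (max (α + λψ) 0)^p = 1`. -/
def IsSol {N : ℕ} (Ω : Set (EuclideanSpace ℝ (Fin N))) (p lam α : ℝ)
    (ψ : EuclideanSpace ℝ (Fin N) → ℝ) : Prop :=
  ContDiff ℝ 2 ψ ∧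
  (∀ x ∈ Ω, -lapl ψ x = (max (α + lam * ψ x) 0) ^ p) ∧
  (∀ x ∈ frontier Ω, ψ x = 0) ∧
  (∫ x in Ω, (max (α + lam * ψ x) 0) ^ p) = 1

/-- The radius `R_N` of the ball in `ℝ^N` centered at the origin with unit volume. -/
def RN (N : ℕ) : ℝ :=
  (volume (ball (0 : EuclideanSpace ℝ (Fin N)) 1)).toReal ^ (-(1 : ℝ) / (N : ℝ))

/-- `𝔻_N`: the open ball in `ℝ^N` centered at the origin with unit volume. -/
def DN (N : ℕ) : Set (EuclideanSpace ℝ (Fin N)) := ball 0 (RN N)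

theorem hasDerivAt_comp_line {N : ℕ} {u : EuclideanSpace ℝ (Fin N) → ℝ} (hu : ContDiff ℝ 2 u)
    (x d : EuclideanSpace ℝ (Fin N)) (t : ℝ) :
    HasDerivAt (fun s : ℝ => u (x + s • d)) (fderiv ℝ u (x + t • d) d) t := by
  have h1 : HasFDerivAt u (fderiv ℝ u (x + t • d)) (x + t • d) :=
    (hu.differentiable (by norm_num) _).hasFDerivAt
  have h2 : HasDerivAt (fun s : ℝ => x + s • d) d t := by
    simpa using ((hasDerivAt_id t).smul_const d).const_add x
  exact h1.comp_hasDerivAt t h2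

theorem differentiable_fderiv_of_contDiff_two {N : ℕ} {u : EuclideanSpace ℝ (Fin N) → ℝ}
    (hu : ContDiff ℝ 2 u) : Differentiable ℝ (fderiv ℝ u) :=
  (hu.fderiv_right (m := 1) (by norm_num)).differentiable (by norm_num)

theorem deriv_deriv_comp_line {N : ℕ} {u : EuclideanSpace ℝ (Fin N) → ℝ} (hu : ContDiff ℝ 2 u)
    (x d : EuclideanSpace ℝ (Fin N)) :
    deriv (deriv (fun s : ℝ => u (x + s • d))) 0 = fderiv ℝ (fderiv ℝ u) x d d := by
  have h : deriv (fun s : ℝ => u (x + s • d)) = fun s => fderiv ℝ u (x + s • d) d :=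
    funext fun s => (hasDerivAt_comp_line hu x d s).deriv
  rw [h]
  have h1 : HasFDerivAt (fderiv ℝ u) (fderiv ℝ (fderiv ℝ u) x) (x + (0 : ℝ) • d) := by
    simpa using (differentiable_fderiv_of_contDiff_two hu x).hasFDerivAt
  have h2 : HasDerivAt (fun s : ℝ => x + s • d) d 0 := by
    simpa using ((hasDerivAt_id (0 : ℝ)).smul_const d).const_add x
  have h3 := h1.comp_hasDerivAt (0 : ℝ) h2
  simpa using (h3.clm_apply (hasDerivAt_const (0 : ℝ) d)).deriv

theorem lapl_eq_sum_fderiv {N : ℕ} {u : EuclideanSpace ℝ (Fin N) → ℝ} (hu : ContDiff ℝ 2 u)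
    (x : EuclideanSpace ℝ (Fin N)) :
    lapl u x = ∑ i, fderiv ℝ (fderiv ℝ u) x (EuclideanSpace.single i (1 : ℝ))
      (EuclideanSpace.single i (1 : ℝ)) := by
  refine Finset.sum_congr rfl fun i _ => ?_
  have h1 := ((differentiable_fderiv_of_contDiff_two hu x).hasFDerivAt.clm_apply
    (hasFDerivAt_const (EuclideanSpace.single i (1 : ℝ)) x)).fderiv
  rw [h1]; simp

theorem lapl_eq_laplacian {N : ℕ} {u : EuclideanSpace ℝ (Fin N) → ℝ} (hu : ContDiff ℝ 2 u)
    (x : EuclideanSpace ℝ (Fin N)) : lapl u x = Laplacian.laplacian u x := by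
  rw [lapl_eq_sum_fderiv hu, InnerProductSpace.laplacian_eq_iteratedFDeriv_orthonormalBasis u
    (EuclideanSpace.basisFun (Fin N) ℝ)]
  simp [iteratedFDeriv_two_apply]

theorem lapl_eq_sum_orthonormalBasis {N : ℕ} {u : EuclideanSpace ℝ (Fin N) → ℝ}
    (hu : ContDiff ℝ 2 u) (x : EuclideanSpace ℝ (Fin N))
    (v : OrthonormalBasis (Fin N) ℝ (EuclideanSpace ℝ (Fin N))) :
    lapl u x = ∑ i, deriv (deriv (fun t : ℝ => u (x + t • v i))) 0 := by
  rw [lapl_eq_laplacian hu, InnerProductSpace.laplacian_eq_iteratedFDeriv_orthonormalBasis u v]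
  simp [iteratedFDeriv_two_apply, deriv_deriv_comp_line hu]

theorem lapl_eq_sum_single {N : ℕ} {u : EuclideanSpace ℝ (Fin N) → ℝ}
    (hu : ContDiff ℝ 2 u) (x : EuclideanSpace ℝ (Fin N)) :
    lapl u x = ∑ i, deriv (deriv (fun t : ℝ => u (x + t • EuclideanSpace.single i (1 : ℝ)))) 0 := by
  simpa using lapl_eq_sum_orthonormalBasis hu x (EuclideanSpace.basisFun (Fin N) ℝ)

theorem lapl_add_const_mul {N : ℕ} {u v : EuclideanSpace ℝ (Fin N) → ℝ}
    (hu : ContDiff ℝ 2 u) (hv : ContDiff ℝ 2 v) (c : ℝ) (x : EuclideanSpace ℝ (Fin N)) :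
    lapl (fun y => u y + c * v y) x = lapl u x + c * lapl v x := by
  have hv' : ContDiff ℝ 2 (c • v) := contDiff_const.smul hv
  have h : (fun y => u y + c * v y) = u + c • v := by ext y; simp
  have huv : ContDiff ℝ 2 (u + c • v) := hu.add hv'
  rw [h, lapl_eq_laplacian huv, lapl_eq_laplacian hu, lapl_eq_laplacian hv,
    hu.contDiffAt.laplacian_add hv'.contDiffAt, InnerProductSpace.laplacian_smul c hv.contDiffAt,
    smul_eq_mul]

theorem deriv_deriv_nonneg_of_isLocalMin {g : ℝ → ℝ} {a : ℝ} (hg : Continuous g)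
    (h : IsLocalMin g a) : 0 ≤ deriv (deriv g) a := by
  by_contra! hneg
  have hmax := isLocalMax_of_deriv_deriv_neg hneg h.deriv_eq_zero hg.continuousAt
  have heq : g =ᶠ[nhds a] fun _ => g a := by
    filter_upwards [h, hmax] with t h1 h2 using le_antisymm h2 h1
  have : deriv (deriv g) a = 0 := by
    rw [heq.deriv.deriv_eq]; simp
  exact hneg.ne this

theorem lapl_nonneg_of_isLocalMin {N : ℕ} {u : EuclideanSpace ℝ (Fin N) → ℝ}
    (hu : ContDiff ℝ 2 u) {x : EuclideanSpace ℝ (Fin N)} (h : IsLocalMin u x) : 0 ≤ lapl u x := by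
  rw [lapl_eq_sum_single hu]
  refine Finset.sum_nonneg fun i _ => deriv_deriv_nonneg_of_isLocalMin ?_ ?_
  · exact hu.continuous.comp (by fun_prop)
  · have hc : ContinuousAt (fun t : ℝ => x + t • EuclideanSpace.single i (1 : ℝ)) 0 := by fun_prop
    have ht : Filter.Tendsto (fun t : ℝ => x + t • EuclideanSpace.single i (1 : ℝ)) (nhds 0)
        (nhds x) := by simpa using hc.tendsto
    filter_upwards [ht.eventually h] with t ht
    simpa using ht

/-- Reflection through the hyperplane `⟪x, e⟫ = μ`, for a unit vector `e`. -/
def hyperplaneRefl {N : ℕ} (e : EuclideanSpace ℝ (Fin N)) (μ : ℝ)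
    (x : EuclideanSpace ℝ (Fin N)) : EuclideanSpace ℝ (Fin N) :=
  x - (2 * (inner ℝ x e - μ)) • e

theorem contDiff_hyperplaneRefl {N : ℕ} (e : EuclideanSpace ℝ (Fin N)) (μ : ℝ) :
    ContDiff ℝ 2 (hyperplaneRefl e μ) := by
  have h : ContDiff ℝ 2 (fun x : EuclideanSpace ℝ (Fin N) => inner ℝ x e) :=
    contDiff_id.inner ℝ contDiff_const
  unfold hyperplaneRefl
  fun_prop

theorem norm_sq_hyperplaneRefl {N : ℕ} {e : EuclideanSpace ℝ (Fin N)} (he : ‖e‖ = 1) (μ : ℝ)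
    (x : EuclideanSpace ℝ (Fin N)) :
    ‖hyperplaneRefl e μ x‖ ^ 2 = ‖x‖ ^ 2 - 4 * μ * (inner ℝ x e - μ) := by
  unfold hyperplaneRefl
  rw [norm_sub_sq_real, inner_smul_right, norm_smul, he, mul_one, Real.norm_eq_abs, sq_abs]
  ring

theorem hyperplaneRefl_eq_self {N : ℕ} {e : EuclideanSpace ℝ (Fin N)} {μ : ℝ}
    {x : EuclideanSpace ℝ (Fin N)} (h : inner ℝ x e = μ) : hyperplaneRefl e μ x = x := by
  simp [hyperplaneRefl, h]

theorem lapl_comp_hyperplaneRefl {N : ℕ} {u : EuclideanSpace ℝ (Fin N) → ℝ}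
    (hu : ContDiff ℝ 2 u) {e : EuclideanSpace ℝ (Fin N)} (he : ‖e‖ = 1) (μ : ℝ)
    (x : EuclideanSpace ℝ (Fin N)) :
    lapl (fun y => u (hyperplaneRefl e μ y)) x = lapl u (hyperplaneRefl e μ x) := by
  have hl : ∀ y, (Submodule.reflection (Submodule.span ℝ {e})ᗮ) y = y - (2 * inner ℝ y e) • e := by
    intro y
    rw [Submodule.reflection_orthogonal_apply, Submodule.reflection_singleton_apply]
    simp [he, real_inner_comm, mul_smul, two_smul]
  set ρ := Submodule.reflection (Submodule.span ℝ {e})ᗮ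
  have hc : ContDiff ℝ 2 (fun y => u (hyperplaneRefl e μ y)) :=
    hu.comp (contDiff_hyperplaneRefl e μ)
  rw [lapl_eq_sum_single hc,
    lapl_eq_sum_orthonormalBasis hu _ ((EuclideanSpace.basisFun (Fin N) ℝ).map ρ)]
  refine Finset.sum_congr rfl fun i _ => ?_
  congr 2
  ext t
  congr 1
  simp only [OrthonormalBasis.map_apply, EuclideanSpace.basisFun_apply, hl, hyperplaneRefl,
    inner_add_left, real_inner_smul_left]
  module

theorem contDiff_cos_inner {N : ℕ} (e : EuclideanSpace ℝ (Fin N)) (k μ : ℝ) :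
    ContDiff ℝ 2 (fun y : EuclideanSpace ℝ (Fin N) => Real.cos (k * (inner ℝ y e - μ))) := by
  have h : ContDiff ℝ 2 (fun x : EuclideanSpace ℝ (Fin N) => inner ℝ x e) :=
    contDiff_id.inner ℝ contDiff_const
  exact (contDiff_const.mul (h.sub contDiff_const)).cos

theorem lapl_cos_inner {N : ℕ} {e : EuclideanSpace ℝ (Fin N)} (he : ‖e‖ = 1) (k μ : ℝ)
    (x : EuclideanSpace ℝ (Fin N)) :
    lapl (fun y => Real.cos (k * (inner ℝ y e - μ))) x
      = -k ^ 2 * Real.cos (k * (inner ℝ x e - μ)) := by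
  have hc : ContDiff ℝ 2 (fun y : EuclideanSpace ℝ (Fin N) => Real.cos (k * (inner ℝ y e - μ))) :=
    contDiff_cos_inner e k μ
  rw [lapl_eq_sum_single hc]
  have h1 : ∀ i, deriv (deriv (fun t : ℝ => Real.cos (k * (inner ℝ
      (x + t • EuclideanSpace.single i (1 : ℝ)) e - μ)))) 0
      = -k ^ 2 * Real.cos (k * (inner ℝ x e - μ)) * (e i) ^ 2 := by
    intro i
    have hin : ∀ t : ℝ, inner ℝ (x + t • EuclideanSpace.single i (1 : ℝ)) e
        = inner ℝ x e + t * e i := by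
      intro t
      rw [inner_add_left, real_inner_smul_left, EuclideanSpace.inner_single_left]
      simp
    simp only [hin]
    have hlin : ∀ t : ℝ, HasDerivAt (fun t : ℝ => k * (inner ℝ x e + t * e i - μ)) (k * e i) t := by
      intro t
      have := (((hasDerivAt_id t).mul_const (e i)).const_add (inner ℝ x e)).sub_const μ
      simpa using this.const_mul k
    have hd : deriv (fun t : ℝ => Real.cos (k * (inner ℝ x e + t * e i - μ)))
        = fun t => -Real.sin (k * (inner ℝ x e + t * e i - μ)) * (k * e i) :=
      funext fun t => (hlin t).cos.deriv
    rw [hd]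
    refine (((hlin 0).sin.neg).mul_const (k * e i)).deriv.trans ?_
    simp; ring
  simp only [h1]
  rw [← Finset.mul_sum, ← EuclideanSpace.real_norm_sq_eq, he]
  ring

theorem contDiff_exp_neg_norm_sq {N : ℕ} (a : ℝ) (z : EuclideanSpace ℝ (Fin N)) :
    ContDiff ℝ 2 (fun y : EuclideanSpace ℝ (Fin N) => Real.exp (-a * ‖y - z‖ ^ 2)) := by
  have h : ContDiff ℝ 2 (fun y : EuclideanSpace ℝ (Fin N) => ‖y - z‖ ^ 2) :=
    (contDiff_norm_sq ℝ).comp (contDiff_id.sub contDiff_const)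
  exact (contDiff_const.mul h).exp

theorem lapl_exp_neg_norm_sq {N : ℕ} (a : ℝ) (z x : EuclideanSpace ℝ (Fin N)) :
    lapl (fun y => Real.exp (-a * ‖y - z‖ ^ 2)) x
      = (4 * a ^ 2 * ‖x - z‖ ^ 2 - 2 * a * N) * Real.exp (-a * ‖x - z‖ ^ 2) := by
  have hc := contDiff_exp_neg_norm_sq a z
  rw [lapl_eq_sum_single hc]
  have h1 : ∀ i, deriv (deriv (fun t : ℝ => Real.exp (-a * ‖
      (x + t • EuclideanSpace.single i (1 : ℝ)) - z‖ ^ 2))) 0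
      = (4 * a ^ 2 * ((x - z) i) ^ 2 - 2 * a) * Real.exp (-a * ‖x - z‖ ^ 2) := by
    intro i
    have hin : ∀ t : ℝ, ‖(x + t • EuclideanSpace.single i (1 : ℝ)) - z‖ ^ 2
        = ‖x - z‖ ^ 2 + 2 * t * (x - z) i + t ^ 2 := by
      intro t
      rw [show (x + t • EuclideanSpace.single i (1 : ℝ)) - z
        = (x - z) + t • EuclideanSpace.single i (1 : ℝ) by abel, norm_add_sq_real,
        real_inner_smul_right, EuclideanSpace.inner_single_right, norm_smul]
      simp
      ring
    simp only [hin]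
    have hlin : ∀ t : ℝ, HasDerivAt (fun t : ℝ => -a * (‖x - z‖ ^ 2 + 2 * t * (x - z) i + t ^ 2))
        (-a * (2 * (x - z) i + 2 * t)) t := by
      intro t
      have h2 := (((hasDerivAt_id t).const_mul 2).mul_const ((x - z) i)).const_add (‖x - z‖ ^ 2)
      have := (h2.add (hasDerivAt_pow 2 t)).const_mul (-a)
      simpa using this
    have hd : deriv (fun t : ℝ => Real.exp (-a * (‖x - z‖ ^ 2 + 2 * t * (x - z) i + t ^ 2)))
        = fun t => Real.exp (-a * (‖x - z‖ ^ 2 + 2 * t * (x - z) i + t ^ 2)) *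
          (-a * (2 * (x - z) i + 2 * t)) :=
      funext fun t => (hlin t).exp.deriv
    have hl2 : HasDerivAt (fun t : ℝ => -a * (2 * (x - z) i + 2 * t)) (-a * 2) 0 := by
      simpa using (((hasDerivAt_id (0 : ℝ)).const_mul 2).const_add (2 * (x - z) i)).const_mul (-a)
    rw [hd]
    refine ((hlin 0).exp.mul hl2).deriv.trans ?_
    simp; ring
  simp only [h1]
  rw [← Finset.sum_mul, Finset.sum_sub_distrib, ← Finset.mul_sum, ← EuclideanSpace.real_norm_sq_eq]
  simp
  ring_nf

theorem comparison_nonneg {N : ℕ} {K : Set (EuclideanSpace ℝ (Fin N))} (hK : IsCompact K)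
    {w g : EuclideanSpace ℝ (Fin N) → ℝ} (hw : ContDiff ℝ 2 w) (hg : ContDiff ℝ 2 g)
    (hgpos : ∀ x ∈ K, 0 < g x)
    (hneg : ∀ x ∈ K, w x < 0 → x ∈ interior K ∧
      ∀ τ > 0, w x = -τ * g x → lapl w x + τ * lapl g x < 0) :
    ∀ x ∈ K, 0 ≤ w x := by
  by_contra! hcon
  obtain ⟨x₁, hx₁, hwx₁⟩ := hcon
  obtain ⟨x, hx, hmin⟩ := hK.exists_isMinOn ⟨x₁, hx₁⟩
    (hw.continuous.continuousOn.div hg.continuous.continuousOn fun x hx => (hgpos x hx).ne')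
  have hgx := hgpos x hx
  have hle : w x / g x < 0 :=
    lt_of_le_of_lt (hmin hx₁) (div_neg_of_neg_of_pos hwx₁ (hgpos x₁ hx₁))
  have hwx : w x < 0 := by
    by_contra! h
    exact absurd (div_nonneg h hgx.le) (not_le.2 hle)
  obtain ⟨hint, hlap⟩ := hneg x hx hwx
  set τ := -(w x / g x) with hτ
  have h0 : w x = -τ * g x := by rw [hτ]; field_simp
  have hlt := hlap τ (by linarith) h0
  rw [← lapl_add_const_mul hw hg τ x] at hlt
  refine absurd (lapl_nonneg_of_isLocalMin (hw.add (contDiff_const.mul hg)) ?_) (not_le.2 hlt)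
  filter_upwards [mem_interior_iff_mem_nhds.1 hint] with y hy
  have h1 : -τ ≤ w y / g y := by rw [hτ, neg_neg]; exact hmin hy
  rw [le_div_iff₀ (hgpos y hy)] at h1
  rw [h0]
  linarith

theorem lapl_const {N : ℕ} (c : ℝ) (x : EuclideanSpace ℝ (Fin N)) : lapl (fun _ => c) x = 0 := by
  simp [lapl]

theorem minimum_principle {N : ℕ} {K : Set (EuclideanSpace ℝ (Fin N))} (hK : IsCompact K)
    {w : EuclideanSpace ℝ (Fin N) → ℝ} (hw : ContDiff ℝ 2 w)
    (hneg : ∀ x ∈ K, w x < 0 → x ∈ interior K ∧ lapl w x < 0) :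
    ∀ x ∈ K, 0 ≤ w x :=
  comparison_nonneg hK hw (contDiff_const (c := (1 : ℝ))) (fun _ _ => one_pos) fun x hx h =>
    ⟨(hneg x hx h).1, fun τ _ _ => by rw [lapl_const]; simpa using (hneg x hx h).2⟩

theorem superharmonic_pos_of_center_pos {N : ℕ} {w : EuclideanSpace ℝ (Fin N) → ℝ}
    (hw : ContDiff ℝ 2 w) {z : EuclideanSpace ℝ (Fin N)} {ρ : ℝ}
    (hnn : ∀ x ∈ closedBall z ρ, 0 ≤ w x) (hlap : ∀ x ∈ ball z ρ, lapl w x ≤ 0)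
    (hz : 0 < w z) : ∀ x ∈ ball z ρ, 0 < w x := by
  intro x hx
  have hev : ∀ᶠ y in nhds z, w z / 2 < w y :=
    hw.continuous.continuousAt.eventually_const_lt (half_lt_self hz)
  obtain ⟨r, hr, hball⟩ := Metric.nhds_basis_closedBall.eventually_iff.1 hev
  by_cases hxr : x ∈ closedBall z r
  · exact (half_pos hz).trans (hball hxr)
  rw [mem_closedBall, not_le, dist_eq_norm] at hxr
  rw [mem_ball, dist_eq_norm] at hx
  set a : ℝ := (N + 1) / (2 * r ^ 2) with ha
  have ha0 : 0 < a := by positivity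
  have har : 4 * a ^ 2 * r ^ 2 = 2 * a * (N + 1) := by rw [ha]; field_simp; ring
  set ε : ℝ := w z / 2 with hε
  have hε0 : 0 < ε := half_pos hz
  set F : EuclideanSpace ℝ (Fin N) → ℝ := fun y =>
    (w y + ε * Real.exp (-a * ρ ^ 2) * 1) + (-ε) * Real.exp (-a * ‖y - z‖ ^ 2) with hF
  have hC1 : ContDiff ℝ 2 fun y => w y + ε * Real.exp (-a * ρ ^ 2) * 1 := hw.add contDiff_const
  have hFC : ContDiff ℝ 2 F := hC1.add (contDiff_const.mul (contDiff_exp_neg_norm_sq a z))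
  have hFl : ∀ y, lapl F y = lapl w y -
      ε * ((4 * a ^ 2 * ‖y - z‖ ^ 2 - 2 * a * N) * Real.exp (-a * ‖y - z‖ ^ 2)) := by
    intro y
    rw [hF, lapl_add_const_mul hC1 (contDiff_exp_neg_norm_sq a z), lapl_exp_neg_norm_sq,
      lapl_add_const_mul hw contDiff_const, lapl_const]
    ring
  have hK : IsCompact (closedBall z ρ \ ball z r) := (isCompact_closedBall z ρ).diff isOpen_ball
  have key := minimum_principle hK hFC ?_ x ?_
  · have hexp : Real.exp (-a * ρ ^ 2) < Real.exp (-a * ‖x - z‖ ^ 2) := by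
      apply Real.exp_lt_exp.2
      have : ‖x - z‖ ^ 2 < ρ ^ 2 := by gcongr
      nlinarith
    simp only [hF] at key
    nlinarith
  · rintro y ⟨hy1, hy2⟩ hFy
    rw [mem_closedBall, dist_eq_norm] at hy1
    rw [mem_ball, dist_eq_norm, not_lt] at hy2
    have hwy := hnn y (by rwa [mem_closedBall, dist_eq_norm])
    have hlt1 : ‖y - z‖ < ρ := by
      refine lt_of_le_of_ne hy1 fun h => ?_
      simp only [hF, h] at hFy
      linarith
    have hlt2 : r < ‖y - z‖ := by
      refine lt_of_le_of_ne hy2 fun h => ?_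
      have h1 : ε < w y := hball (by rw [mem_closedBall, dist_eq_norm, h])
      have h2 : Real.exp (-a * ‖y - z‖ ^ 2) ≤ 1 := Real.exp_le_one_iff.2 (by
        have := sq_nonneg ‖y - z‖
        nlinarith)
      have h3 := Real.exp_pos (-a * ρ ^ 2)
      simp only [hF] at hFy
      nlinarith [mul_pos hε0 h3]
    refine ⟨mem_interior.2 ⟨ball z ρ \ closedBall z r, ?_, isOpen_ball.sdiff isClosed_closedBall,
      ?_⟩, ?_⟩
    · exact sdiff_subset_sdiff ball_subset_closedBall ball_subset_closedBall
    · simp only [mem_sdiff, mem_ball, mem_closedBall, dist_eq_norm, not_le]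
      exact ⟨hlt1, hlt2⟩
    · rw [hFl]
      have h1 := hlap y (by rwa [mem_ball, dist_eq_norm])
      have h2 : r ^ 2 < ‖y - z‖ ^ 2 := by gcongr
      have h3 : 0 < 4 * a ^ 2 * ‖y - z‖ ^ 2 - 2 * a * N := by
        have : 4 * a ^ 2 * r ^ 2 < 4 * a ^ 2 * ‖y - z‖ ^ 2 := by gcongr
        nlinarith
      have h4 := mul_pos hε0 (mul_pos h3 (Real.exp_pos (-a * ‖y - z‖ ^ 2)))
      linarith
  · simp only [mem_sdiff, mem_ball, mem_closedBall, dist_eq_norm, not_lt]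
    exact ⟨hx.le, hxr.le⟩

theorem strong_minimum_principle {N : ℕ} {w : EuclideanSpace ℝ (Fin N) → ℝ}
    (hw : ContDiff ℝ 2 w) {U : Set (EuclideanSpace ℝ (Fin N))} (hU : IsOpen U)
    (hUc : IsPreconnected U) (hnn : ∀ x ∈ U, 0 ≤ w x) (hlap : ∀ x ∈ U, lapl w x ≤ 0)
    {z : EuclideanSpace ℝ (Fin N)} (hzU : z ∈ U) (hz : 0 < w z) : ∀ x ∈ U, 0 < w x := by
  have hV : IsOpen {x | x ∈ U ∧ 0 < w x} := hU.inter (isOpen_lt continuous_const hw.continuous)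
  have hsub := hUc.subset_of_closure_inter_subset hV ⟨z, hzU, hzU, hz⟩ ?_
  · exact fun x hx => (hsub hx).2
  rintro x ⟨hxc, hxU⟩
  refine ⟨hxU, ?_⟩
  obtain ⟨δ, hδ, hball⟩ := Metric.isOpen_iff.1 hU x hxU
  obtain ⟨y, ⟨hyU, hy⟩, hxy⟩ := Metric.mem_closure_iff.1 hxc (δ / 2) (half_pos hδ)
  have hsub : closedBall y (δ / 2) ⊆ U := by
    refine Subset.trans (fun t ht => ?_) hball
    rw [mem_closedBall] at ht
    rw [mem_ball]
    have := dist_triangle t y x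
    rw [dist_comm y x] at this
    linarith
  exact superharmonic_pos_of_center_pos hw (fun t ht => hnn t (hsub ht))
    (fun t ht => hlap t (hsub (ball_subset_closedBall ht))) hy x (by rwa [mem_ball])

theorem abs_inner_le_norm_of_unit {N : ℕ} {e : EuclideanSpace ℝ (Fin N)} (he : ‖e‖ = 1)
    (x : EuclideanSpace ℝ (Fin N)) : |inner ℝ x e| ≤ ‖x‖ := by
  simpa [he] using abs_real_inner_le_norm x e

theorem superharmonic_pos_ball {N : ℕ} {R : ℝ} (hR : 0 < R) {u : EuclideanSpace ℝ (Fin N) → ℝ}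
    (hu : ContDiff ℝ 2 u) {e : EuclideanSpace ℝ (Fin N)} (he : ‖e‖ = 1)
    (hlap : ∀ x ∈ ball 0 R, lapl u x ≤ 0) (hbd : ∀ x ∈ sphere 0 R, u x = 0)
    (hne : ∃ z ∈ ball 0 R, lapl u z ≠ 0) : ∀ x ∈ ball 0 R, 0 < u x := by
  have hcos : ∀ x ∈ closedBall (0 : EuclideanSpace ℝ (Fin N)) R,
      0 < Real.cos (1 / R * (inner ℝ x e - 0)) := by
    intro x hx
    rw [mem_closedBall_zero_iff] at hx
    have h1 : |1 / R * (inner ℝ x e - 0)| ≤ 1 := by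
      rw [sub_zero, abs_mul, abs_of_pos (by positivity), one_div, inv_mul_le_iff₀ hR]
      linarith [abs_inner_le_norm_of_unit he x]
    exact Real.cos_pos_of_le_one h1
  have hnn : ∀ x ∈ closedBall 0 R, 0 ≤ u x := by
    refine comparison_nonneg (isCompact_closedBall _ _) hu (contDiff_cos_inner e (1 / R) 0) hcos ?_
    intro x hx hux
    have hxR : x ∈ ball 0 R := by
      rw [← closedBall_sdiff_sphere]
      exact ⟨hx, fun h => hux.ne (hbd x h)⟩
    refine ⟨mem_interior.2 ⟨_, ball_subset_closedBall, isOpen_ball, hxR⟩, fun τ hτ _ => ?_⟩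
    rw [lapl_cos_inner he]
    have h1 := hlap x hxR
    have h2 : 0 < (1 / R) ^ 2 := by positivity
    have h3 := mul_pos hτ (mul_pos h2 (hcos x hx))
    linarith
  obtain ⟨z, hzR, hz⟩ := hne
  have hzpos : 0 < u z := by
    refine lt_of_le_of_ne (hnn z (ball_subset_closedBall hzR)) fun h => hz ?_
    refine le_antisymm (hlap z hzR) (lapl_nonneg_of_isLocalMin hu ?_)
    filter_upwards [isOpen_ball.mem_nhds hzR] with y hy
    rw [← h]
    exact hnn y (ball_subset_closedBall hy)
  exact strong_minimum_principle hu isOpen_ball (convex_ball 0 R).isPreconnected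
    (fun x hx => hnn x (ball_subset_closedBall hx)) hlap hzR hzpos

theorem continuous_hyperplaneRefl_uncurry {N : ℕ} (e : EuclideanSpace ℝ (Fin N)) :
    Continuous fun q : ℝ × EuclideanSpace ℝ (Fin N) => hyperplaneRefl e q.1 q.2 := by
  unfold hyperplaneRefl
  have h : Continuous fun q : ℝ × EuclideanSpace ℝ (Fin N) => inner ℝ q.2 e :=
    continuous_snd.inner continuous_const
  fun_prop

theorem norm_hyperplaneRefl_lt {N : ℕ} {e : EuclideanSpace ℝ (Fin N)} (he : ‖e‖ = 1) {μ R : ℝ}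
    (hμ : 0 < μ) {x : EuclideanSpace ℝ (Fin N)} (hx : ‖x‖ ≤ R) (hxe : μ < inner ℝ x e) :
    ‖hyperplaneRefl e μ x‖ < R := by
  have h1 := norm_sq_hyperplaneRefl he μ x
  have h2 : 0 < 4 * μ * (inner ℝ x e - μ) := by
    have : 0 < inner ℝ x e - μ := sub_pos.2 hxe
    positivity
  exact lt_of_lt_of_le (lt_of_pow_lt_pow_left₀ 2 (norm_nonneg _) (by linarith)) hx

section MovingPlanes

variable {N : ℕ} {R L : ℝ} {u : EuclideanSpace ℝ (Fin N) → ℝ} {f : ℝ → ℝ}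
  {e : EuclideanSpace ℝ (Fin N)}

theorem movingPlane_strict (hu : ContDiff ℝ 2 u) (hf : Monotone f)
    (heq : ∀ x ∈ ball 0 R, -lapl u x = f (u x)) (hbd : ∀ x ∈ sphere 0 R, u x = 0)
    (hpos : ∀ x ∈ ball 0 R, 0 < u x) (he : ‖e‖ = 1) {μ : ℝ} (hμ : 0 < μ)
    (hP : ∀ x ∈ closedBall 0 R, μ < inner ℝ x e → u x ≤ u (hyperplaneRefl e μ x)) :
    ∀ x ∈ closedBall 0 R, μ < inner ℝ x e → u x < u (hyperplaneRefl e μ x) := by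
  have hsph : ∀ x ∈ sphere 0 R, μ < inner ℝ x e → u x < u (hyperplaneRefl e μ x) := by
    intro x hx hxe
    rw [hbd x hx]
    rw [mem_sphere_zero_iff_norm] at hx
    exact hpos _ (mem_ball_zero_iff.2 (norm_hyperplaneRefl_lt he hμ hx.le hxe))
  intro x hx hxe
  by_cases hxs : x ∈ sphere 0 R
  · exact hsph x hxs hxe
  have hxb : x ∈ ball 0 R := by rw [← closedBall_sdiff_sphere]; exact ⟨hx, hxs⟩
  have hxn := mem_ball_zero_iff.1 hxb
  have hxabs := (le_abs_self _).trans (abs_inner_le_norm_of_unit he x)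
  have hμR : μ < R := by linarith
  have hin : Continuous fun y : EuclideanSpace ℝ (Fin N) => inner ℝ y e :=
    continuous_id.inner continuous_const
  have hrefl : ContDiff ℝ 2 fun y => u (hyperplaneRefl e μ y) :=
    hu.comp (contDiff_hyperplaneRefl e μ)
  have hw : ContDiff ℝ 2 fun y => u (hyperplaneRefl e μ y) + (-1) * u y :=
    hrefl.add (contDiff_const.mul hu)
  have hlap : ∀ y, lapl (fun y => u (hyperplaneRefl e μ y) + (-1) * u y) y
      = lapl u (hyperplaneRefl e μ y) - lapl u y := by
    intro y
    rw [lapl_add_const_mul hrefl hu, lapl_comp_hyperplaneRefl hu he]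
    ring
  set U : Set (EuclideanSpace ℝ (Fin N)) := ball 0 R ∩ {y | μ < inner ℝ y e} with hUdef
  have hUo : IsOpen U := isOpen_ball.inter (isOpen_lt continuous_const hin)
  have hconv : Convex ℝ {y : EuclideanSpace ℝ (Fin N) | μ < inner ℝ y e} :=
    convex_halfSpace_gt (f := fun y : EuclideanSpace ℝ (Fin N) => inner ℝ y e)
      ⟨fun a b => inner_add_left _ _ _, fun c a => real_inner_smul_left _ _ _⟩ μ
  have hUc : IsPreconnected U := ((convex_ball 0 R).inter hconv).isPreconnected
  have hee : inner ℝ e e = (1 : ℝ) := by rw [real_inner_self_eq_norm_sq, he]; norm_num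
  have hR : 0 < R := hμ.trans hμR
  have hline : Continuous fun s : ℝ => u (hyperplaneRefl e μ (s • e)) + (-1) * u (s • e) :=
    hw.continuous.comp (continuous_id.smul continuous_const)
  have hat : 0 < u (hyperplaneRefl e μ (R • e)) + (-1) * u (R • e) := by
    have := hsph (R • e) (by simp [norm_smul, he, hR.le])
      (by rw [real_inner_smul_left, hee, mul_one]; exact hμR)
    linarith
  have hev : ∀ᶠ s in nhdsWithin R (Iio R), 0 < u (hyperplaneRefl e μ (s • e)) + (-1) * u (s • e) :=
    nhdsWithin_le_nhds (hline.continuousAt.eventually_const_lt hat)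
  have hev2 : ∀ᶠ s in nhdsWithin R (Iio R), s ∈ Ioo μ R :=
    Ioo_mem_nhdsLT hμR
  obtain ⟨s, hs1, hs2⟩ := (hev.and hev2).exists
  have hsU : s • e ∈ U := by
    refine ⟨?_, ?_⟩
    · rw [mem_ball_zero_iff, norm_smul, he, mul_one, Real.norm_eq_abs,
        abs_of_pos (hμ.trans hs2.1)]
      exact hs2.2
    · rw [mem_ofPred_eq, real_inner_smul_left, hee, mul_one]
      exact hs2.1
  have := strong_minimum_principle hw hUo hUc ?_ ?_ hsU hs1 x ⟨hxb, hxe⟩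
  · linarith
  · rintro y ⟨hy1, hy2⟩
    have := hP y (ball_subset_closedBall hy1) hy2
    linarith
  · rintro y ⟨hy1, hy2⟩
    rw [hlap]
    have h1 := heq y hy1
    have h2 := heq _ (mem_ball_zero_iff.2 (norm_hyperplaneRefl_lt he hμ
      (mem_closedBall_zero_iff.1 (ball_subset_closedBall hy1)) hy2))
    have h3 := hf (hP y (ball_subset_closedBall hy1) hy2)
    linarith

theorem movingPlane_step (hu : ContDiff ℝ 2 u) (hf : Monotone f)
    (hLip : ∀ x ∈ closedBall 0 R, ∀ y ∈ closedBall 0 R, |f (u x) - f (u y)| ≤ L * |u x - u y|)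
    (heq : ∀ x ∈ ball 0 R, -lapl u x = f (u x)) (hbd : ∀ x ∈ sphere 0 R, u x = 0)
    (hpos : ∀ x ∈ ball 0 R, 0 < u x) (he : ‖e‖ = 1) {μ : ℝ} (hμ : 0 < μ)
    (hP : ∀ x ∈ closedBall 0 R, μ < inner ℝ x e → u x ≤ u (hyperplaneRefl e μ x)) :
    ∀ᶠ ν in nhdsWithin μ (Iio μ),
      ∀ x ∈ closedBall 0 R, ν < inner ℝ x e → u x ≤ u (hyperplaneRefl e ν x) := by
  have hstrict := movingPlane_strict hu hf heq hbd hpos he hμ hP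
  have hin : Continuous fun y : EuclideanSpace ℝ (Fin N) => inner ℝ y e :=
    continuous_id.inner continuous_const
  obtain ⟨k, hk0, hkL⟩ : ∃ k : ℝ, 0 < k ∧ L < k ^ 2 :=
    ⟨|L| + 1, by positivity, by nlinarith [le_abs_self L, abs_nonneg L]⟩
  set ε := 1 / (2 * k) with hε
  have hε0 : 0 < ε := by positivity
  set K : Set (EuclideanSpace ℝ (Fin N)) := closedBall 0 R ∩ {y | μ + ε ≤ inner ℝ y e}
  have hK : IsCompact K := (isCompact_closedBall 0 R).inter_right
    (isClosed_le continuous_const hin)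
  have hcont : Continuous fun q : ℝ × EuclideanSpace ℝ (Fin N) =>
      u (hyperplaneRefl e q.1 q.2) - u q.2 :=
    (hu.continuous.comp (continuous_hyperplaneRefl_uncurry e)).sub (hu.continuous.comp continuous_snd)
  have hevK : ∀ᶠ ν in nhds μ, ∀ x ∈ K, 0 < u (hyperplaneRefl e ν x) - u x := by
    refine hK.eventually_forall_of_forall_eventually fun x hx => ?_
    refine hcont.continuousAt.eventually_const_lt ?_
    exact sub_pos.2 (hstrict x hx.1 (by have : μ + ε ≤ inner ℝ x e := hx.2; linarith))
  have hev2 : ∀ᶠ ν in nhdsWithin μ (Iio μ), ν ∈ Ioo (max 0 (μ - ε)) μ :=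
    Ioo_mem_nhdsLT (max_lt hμ (by linarith))
  filter_upwards [nhdsWithin_le_nhds hevK, hev2] with ν hνK hν
  have hν0 : 0 < ν := (le_max_left _ _).trans_lt hν.1
  have hνε : μ - ε < ν := (le_max_right _ _).trans_lt hν.1
  have hνμ : ν < μ := hν.2
  have hrefl : ContDiff ℝ 2 fun y => u (hyperplaneRefl e ν y) :=
    hu.comp (contDiff_hyperplaneRefl e ν)
  have hw : ContDiff ℝ 2 fun y => u (hyperplaneRefl e ν y) + (-1) * u y :=
    hrefl.add (contDiff_const.mul hu)
  have hlap : ∀ y, lapl (fun y => u (hyperplaneRefl e ν y) + (-1) * u y) y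
      = lapl u (hyperplaneRefl e ν y) - lapl u y := by
    intro y
    rw [lapl_add_const_mul hrefl hu, lapl_comp_hyperplaneRefl hu he]
    ring
  set Q : Set (EuclideanSpace ℝ (Fin N)) :=
    closedBall 0 R ∩ ({y | ν ≤ inner ℝ y e} ∩ {y | inner ℝ y e ≤ μ + ε})
  have hQ : IsCompact Q := (isCompact_closedBall 0 R).inter_right
    ((isClosed_le continuous_const hin).inter (isClosed_le hin continuous_const))
  have hcos : ∀ x ∈ Q, 0 < Real.cos (k * (inner ℝ x e - μ)) := by
    rintro x ⟨-, h1, h2⟩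
    simp only [mem_ofPred_eq] at h1 h2
    refine Real.cos_pos_of_le_one ?_
    rw [abs_mul, abs_of_pos hk0]
    have : |inner ℝ x e - μ| ≤ ε := abs_le.2 ⟨by linarith, by linarith⟩
    calc k * |inner ℝ x e - μ| ≤ k * ε := by gcongr
      _ ≤ 1 := by rw [hε]; field_simp; norm_num
  have key := comparison_nonneg hQ hw (contDiff_cos_inner e k μ) hcos ?_
  · intro x hx hxe
    by_cases hxK : x ∈ K
    · linarith [hνK x hxK]
    · have hxQ : x ∈ Q := ⟨hx, hxe.le, show inner ℝ x e ≤ μ + ε from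
        le_of_not_ge fun h => hxK ⟨hx, h⟩⟩
      linarith [key x hxQ]
  · intro x hx hwx
    have hxs := hx
    obtain ⟨hxR, hx1, hx2⟩ := hx
    simp only [mem_ofPred_eq] at hx1 hx2
    have hx1' : ν < inner ℝ x e := by
      refine lt_of_le_of_ne hx1 fun h => ?_
      rw [hyperplaneRefl_eq_self h.symm] at hwx
      linarith
    have hx2' : inner ℝ x e < μ + ε := by
      by_contra! h
      linarith [hνK x ⟨hxR, h⟩]
    have hreflb : hyperplaneRefl e ν x ∈ ball 0 R :=
      mem_ball_zero_iff.2 (norm_hyperplaneRefl_lt he hν0 (mem_closedBall_zero_iff.1 hxR) hx1')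
    have hxb : x ∈ ball 0 R := by
      rw [← closedBall_sdiff_sphere]
      refine ⟨hxR, fun h => ?_⟩
      have := hpos _ hreflb
      rw [hbd x h] at hwx
      linarith
    refine ⟨mem_interior.2 ⟨ball 0 R ∩ ({y | ν < inner ℝ y e} ∩ {y | inner ℝ y e < μ + ε}),
      inter_subset_inter ball_subset_closedBall
        (inter_subset_inter (fun y (hy : ν < inner ℝ y e) => hy.le)
          (fun y (hy : inner ℝ y e < μ + ε) => hy.le)),
      isOpen_ball.inter ((isOpen_lt continuous_const hin).inter (isOpen_lt hin continuous_const)),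
      hxb, hx1', hx2'⟩, fun τ hτ h0 => ?_⟩
    rw [hlap, lapl_cos_inner he]
    have h1 := heq x hxb
    have h2 := heq _ hreflb
    have h3 := hLip x hxR _ (ball_subset_closedBall hreflb)
    have hc := mul_pos hτ (hcos x hxs)
    have h4 : |u x - u (hyperplaneRefl e ν x)| = τ * Real.cos (k * (inner ℝ x e - μ)) := by
      rw [abs_of_pos (by linarith)]
      linarith
    rw [h4] at h3
    have h5 := le_of_abs_le h3
    nlinarith [mul_lt_mul_of_pos_right hkL hc]

theorem movingPlane_le (hR : 0 < R) (hu : ContDiff ℝ 2 u) (hf : Monotone f)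
    (hLip : ∀ x ∈ closedBall 0 R, ∀ y ∈ closedBall 0 R, |f (u x) - f (u y)| ≤ L * |u x - u y|)
    (heq : ∀ x ∈ ball 0 R, -lapl u x = f (u x)) (hbd : ∀ x ∈ sphere 0 R, u x = 0)
    (hpos : ∀ x ∈ ball 0 R, 0 < u x) (he : ‖e‖ = 1) :
    ∀ x ∈ closedBall 0 R, 0 < inner ℝ x e → u x ≤ u (hyperplaneRefl e 0 x) := by
  set S : Set ℝ := {μ | ∀ x ∈ closedBall 0 R, μ < inner ℝ x e → u x ≤ u (hyperplaneRefl e μ x)}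
    with hS
  have hSc : IsClosed S := by
    have : S = ⋂ x ∈ closedBall (0 : EuclideanSpace ℝ (Fin N)) R,
        ({μ | inner ℝ x e ≤ μ} ∪ {μ | u x ≤ u (hyperplaneRefl e μ x)}) := by
      ext μ
      simp only [hS, mem_ofPred_eq, mem_iInter, mem_union]
      refine forall₂_congr fun x _ => ?_
      rw [imp_iff_not_or, not_lt]
    rw [this]
    refine isClosed_biInter fun x _ => IsClosed.union (isClosed_le continuous_const continuous_id)
      (isClosed_le continuous_const ?_)
    exact hu.continuous.comp
      ((continuous_hyperplaneRefl_uncurry e).comp (continuous_id.prodMk continuous_const))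
  have hsub : Icc 0 R ⊆ S := by
    refine IsClosed.Icc_subset_of_forall_exists_lt (hSc.inter isClosed_Icc) ?_ ?_
    · intro x hx hxe
      have h1 := (le_abs_self _).trans (abs_inner_le_norm_of_unit he x)
      have h2 := mem_closedBall_zero_iff.1 hx
      linarith
    · rintro μ ⟨hμS, hμ⟩ y hy
      have h1 := movingPlane_step hu hf hLip heq hbd hpos he hμ.1 hμS
      have h2 : ∀ᶠ ν in nhdsWithin μ (Iio μ), ν ∈ Ioo y μ := Ioo_mem_nhdsLT hy
      obtain ⟨ν, hν1, hν2⟩ := (h1.and h2).exists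
      exact ⟨ν, hν1, hν2.1.le, hν2.2⟩
  exact hsub ⟨le_rfl, hR.le⟩

end MovingPlanes

/-- Gidas–Ni–Nirenberg symmetry on a ball, for a nondecreasing nonlinearity. -/
theorem radial_of_positive_solution {N : ℕ} {R L : ℝ} {u : EuclideanSpace ℝ (Fin N) → ℝ}
    {f : ℝ → ℝ} (hR : 0 < R) (hu : ContDiff ℝ 2 u) (hf : Monotone f)
    (hLip : ∀ x ∈ closedBall 0 R, ∀ y ∈ closedBall 0 R, |f (u x) - f (u y)| ≤ L * |u x - u y|)
    (heq : ∀ x ∈ ball 0 R, -lapl u x = f (u x)) (hbd : ∀ x ∈ sphere 0 R, u x = 0)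
    (hpos : ∀ x ∈ ball 0 R, 0 < u x) {x y : EuclideanSpace ℝ (Fin N)} (hx : ‖x‖ ≤ R)
    (hxy : ‖x‖ = ‖y‖) : u x = u y := by
  have main : ∀ x y : EuclideanSpace ℝ (Fin N), ‖x‖ ≤ R → ‖x‖ = ‖y‖ → u x ≤ u y := by
    intro x y hx hxy
    by_cases hne : x = y
    · rw [hne]
    have hd : 0 < ‖x - y‖ := norm_pos_iff.2 (sub_ne_zero.2 hne)
    have hin : 2 * inner ℝ x (x - y) = ‖x - y‖ ^ 2 := by
      rw [norm_sub_sq_real, inner_sub_right, real_inner_self_eq_norm_sq, hxy]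
      ring
    set e := ‖x - y‖⁻¹ • (x - y) with he
    have hen : ‖e‖ = 1 := by
      rw [he, norm_smul, norm_inv, norm_norm, inv_mul_cancel₀ hd.ne']
    have hxe : inner ℝ x e = ‖x - y‖ / 2 := by
      rw [he, real_inner_smul_right]
      field_simp
      linarith
    have h := movingPlane_le hR hu hf hLip heq hbd hpos hen x (mem_closedBall_zero_iff.2 hx)
      (by rw [hxe]; positivity)
    have hrefl : hyperplaneRefl e 0 x = y := by
      rw [hyperplaneRefl, hxe, he, smul_smul, sub_zero, mul_div_cancel₀ _ two_ne_zero,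
        mul_inv_cancel₀ hd.ne', one_smul]
      abel
    rwa [hrefl] at h
  exact le_antisymm (main x y hx hxy) (main y x (hxy ▸ hx) hxy.symm)

theorem abs_posPart_rpow_sub_le {p C : ℝ} (hp : 1 < p) (hC : 0 ≤ C) {x y : ℝ} (hx : x ≤ C)
    (hy : y ≤ C) : |max x 0 ^ p - max y 0 ^ p| ≤ p * C ^ (p - 1) * |x - y| := by
  have h := (convex_Icc (0 : ℝ) C).norm_image_sub_le_of_norm_hasDerivWithin_le
    (f := fun t : ℝ => t ^ p) (f' := fun t => p * t ^ (p - 1)) (C := p * C ^ (p - 1))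
    (fun t _ => (Real.hasDerivAt_rpow_const (Or.inr hp.le)).hasDerivWithinAt) ?_
    (x := max y 0) ⟨le_max_right _ _, max_le hy hC⟩ (y := max x 0) ⟨le_max_right _ _, max_le hx hC⟩
  · refine h.trans ?_
    have h0 : 0 ≤ p * C ^ (p - 1) := by positivity
    exact mul_le_mul_of_nonneg_left (abs_max_sub_max_le_abs x y 0) h0
  · rintro t ⟨ht0, htC⟩
    rw [Real.norm_of_nonneg (by positivity)]
    have : t ^ (p - 1) ≤ C ^ (p - 1) := Real.rpow_le_rpow ht0 htC (by linarith)
    gcongr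

theorem monotone_posPart_rpow {p : ℝ} (hp : 1 < p) : Monotone fun x : ℝ => max x 0 ^ p :=
  fun _ _ h => Real.rpow_le_rpow (le_max_right _ _) (max_le_max_right 0 h) (by linarith)

theorem continuous_posPart_rpow {p : ℝ} (hp : 1 < p) : Continuous fun x : ℝ => max x 0 ^ p :=
  (continuous_id.max continuous_const).rpow_const fun _ => Or.inr (by linarith)

theorem posPart_rpow_nonneg (p x : ℝ) : 0 ≤ max x 0 ^ p :=
  Real.rpow_nonneg (le_max_right _ _) _

/-- `φ` is a radial profile in dimension `n + 2`: `φ'' + (n + 1) / r * φ' = -(α + λ φ)₊ ^ p` on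
`(0, R)`, with `φ'(0) = 0`. -/
structure IsRadialProfile (n : ℕ) (R p lam α : ℝ) (φ : ℝ → ℝ) : Prop where
  contDiff : ContDiff ℝ 2 φ
  deriv_zero : deriv φ 0 = 0
  ode : ∀ r ∈ Ioo 0 R,
    deriv (deriv φ) r + (n + 1) / r * deriv φ r = -(max (α + lam * φ r) 0) ^ p

/-- The flux `-r ^ (n + 1) φ'(r)`. -/
def flux (n : ℕ) (φ : ℝ → ℝ) (r : ℝ) : ℝ := -(r ^ (n + 1) * deriv φ r)

theorem flux_zero (n : ℕ) (φ : ℝ → ℝ) : flux n φ 0 = 0 := by simp [flux]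

theorem hasDerivAt_deriv_of_contDiff_two {φ : ℝ → ℝ} (h : ContDiff ℝ 2 φ) (r : ℝ) :
    HasDerivAt (deriv φ) (deriv (deriv φ) r) r :=
  ((h.iterate_deriv' 1 1).differentiable (by norm_num) r).hasDerivAt

theorem hasDerivAt_of_contDiff_two {φ : ℝ → ℝ} (h : ContDiff ℝ 2 φ) (r : ℝ) :
    HasDerivAt φ (deriv φ r) r :=
  (h.differentiable (by norm_num) r).hasDerivAt

theorem continuous_deriv_of_contDiff_two {φ : ℝ → ℝ} (h : ContDiff ℝ 2 φ) :
    Continuous (deriv φ) :=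
  h.continuous_deriv (by norm_num)

namespace IsRadialProfile

variable {n : ℕ} {R p lam α : ℝ} {φ : ℝ → ℝ}

theorem continuous_flux (H : IsRadialProfile n R p lam α φ) : Continuous (flux n φ) := by
  have := continuous_deriv_of_contDiff_two H.contDiff
  unfold flux
  fun_prop

theorem hasDerivAt_flux (H : IsRadialProfile n R p lam α φ) {r : ℝ} (hr : r ∈ Ioo 0 R) :
    HasDerivAt (flux n φ) (r ^ (n + 1) * (max (α + lam * φ r) 0) ^ p) r := by
  have h := ((hasDerivAt_pow (n + 1) r).mul (hasDerivAt_deriv_of_contDiff_two H.contDiff r)).neg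
  refine h.congr_deriv ?_
  have hode := H.ode r hr
  have hr0 : r ≠ 0 := hr.1.ne'
  have h2 : deriv (deriv φ) r = -(max (α + lam * φ r) 0) ^ p - (n + 1) / r * deriv φ r := by
    linarith
  rw [h2]
  field_simp
  push_cast
  ring

theorem monotoneOn_flux (H : IsRadialProfile n R p lam α φ) : MonotoneOn (flux n φ) (Icc 0 R) := by
  refine monotoneOn_of_deriv_nonneg (convex_Icc 0 R) H.continuous_flux.continuousOn ?_ ?_
  · rw [interior_Icc]
    exact fun r hr => (H.hasDerivAt_flux hr).differentiableAt.differentiableWithinAt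
  · rw [interior_Icc]
    intro r hr
    rw [(H.hasDerivAt_flux hr).deriv]
    exact mul_nonneg (pow_nonneg hr.1.le _) (posPart_rpow_nonneg _ _)

theorem flux_nonneg (H : IsRadialProfile n R p lam α φ) {r : ℝ} (hr : r ∈ Icc 0 R) :
    0 ≤ flux n φ r := by
  rw [← flux_zero n φ]
  exact H.monotoneOn_flux ⟨le_rfl, hr.1.trans hr.2⟩ hr hr.1

theorem deriv_nonpos (H : IsRadialProfile n R p lam α φ) {r : ℝ} (hr : r ∈ Ioc 0 R) :
    deriv φ r ≤ 0 := by
  have h := H.flux_nonneg ⟨hr.1.le, hr.2⟩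
  by_contra! hd
  have := mul_pos (pow_pos hr.1 (n + 1)) hd
  rw [flux] at h
  linarith

theorem antitoneOn (H : IsRadialProfile n R p lam α φ) (hlam : 0 ≤ lam) :
    AntitoneOn (fun r => α + lam * φ r) (Icc 0 R) := by
  have h : AntitoneOn φ (Icc 0 R) := by
    refine antitoneOn_of_deriv_nonpos (convex_Icc 0 R) H.contDiff.continuous.continuousOn
      (H.contDiff.differentiable (by norm_num)).differentiableOn ?_
    rw [interior_Icc]
    exact fun r hr => H.deriv_nonpos ⟨hr.1, hr.2.le⟩
  intro a ha b hb hab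
  have := mul_le_mul_of_nonneg_left (h ha hb hab) hlam
  show α + lam * φ b ≤ α + lam * φ a
  linarith

theorem center_pos (H : IsRadialProfile n R p lam α φ) (hp : 1 < p) (hlam : 0 ≤ lam) (hR : 0 < R)
    (hc : 0 < flux n φ R) : 0 < α + lam * φ 0 := by
  by_contra! hneg
  have hanti : AntitoneOn (flux n φ) (Icc 0 R) := by
    refine antitoneOn_of_deriv_nonpos (convex_Icc 0 R) H.continuous_flux.continuousOn ?_ ?_
    · rw [interior_Icc]
      exact fun r hr => (H.hasDerivAt_flux hr).differentiableAt.differentiableWithinAt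
    · rw [interior_Icc]
      intro r hr
      have hv : α + lam * φ r ≤ 0 :=
        (H.antitoneOn hlam ⟨le_rfl, hR.le⟩ ⟨hr.1.le, hr.2.le⟩ hr.1.le).trans hneg
      rw [(H.hasDerivAt_flux hr).deriv, max_eq_right hv, Real.zero_rpow (by linarith), mul_zero]
  have := hanti ⟨le_rfl, hR.le⟩ ⟨hR.le, le_rfl⟩ hR.le
  rw [flux_zero] at this
  linarith

theorem flux_pos (H : IsRadialProfile n R p lam α φ) (hp : 1 < p) (hlam : 0 ≤ lam)
    (hc : 0 < flux n φ R) {r : ℝ} (hr : r ∈ Ioc 0 R) : 0 < flux n φ r := by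
  have hR : 0 < R := hr.1.trans_le hr.2
  by_contra! hneg
  have hv0 := H.center_pos hp hlam hR hc
  have hcont : Continuous fun s => α + lam * φ s :=
    continuous_const.add (continuous_const.mul H.contDiff.continuous)
  have h1 : ∀ᶠ s in nhdsWithin 0 (Ioi 0), 0 < α + lam * φ s :=
    nhdsWithin_le_nhds (hcont.continuousAt.eventually_const_lt hv0)
  have h2 : ∀ᶠ s in nhdsWithin (0 : ℝ) (Ioi 0), s ∈ Ioo 0 r := Ioo_mem_nhdsGT hr.1
  obtain ⟨s, hs1, hs2⟩ := (h1.and h2).exists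
  have hzero : flux n φ =ᶠ[nhds s] fun _ => 0 := by
    filter_upwards [isOpen_Ioo.mem_nhds hs2] with t ht
    have htR : t ∈ Icc 0 R := ⟨ht.1.le, ht.2.le.trans hr.2⟩
    exact le_antisymm ((H.monotoneOn_flux htR ⟨hr.1.le, hr.2⟩ ht.2.le).trans hneg)
      (H.flux_nonneg htR)
  have h3 := (H.hasDerivAt_flux ⟨hs2.1, hs2.2.trans_le hr.2⟩).deriv
  rw [hzero.deriv_eq, deriv_const] at h3
  have h4 : 0 < s ^ (n + 1) * max (α + lam * φ s) 0 ^ p :=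
    mul_pos (pow_pos hs2.1 (n + 1)) (Real.rpow_pos_of_pos (lt_max_of_lt_left hs1) p)
  exact h4.ne h3

theorem flux_le (H : IsRadialProfile n R p lam α φ) (hp : 1 < p) (hlam : 0 ≤ lam) {r : ℝ}
    (hr : r ∈ Icc 0 R) :
    (n + 2) * flux n φ r ≤ max (α + lam * φ 0) 0 ^ p * r ^ (n + 2) := by
  have hd : ∀ s ∈ Ioo 0 R, HasDerivAt
      (fun s => (n + 2) * flux n φ s - max (α + lam * φ 0) 0 ^ p * s ^ (n + 2))
      ((n + 2) * s ^ (n + 1) * (max (α + lam * φ s) 0 ^ p - max (α + lam * φ 0) 0 ^ p)) s := by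
    intro s hs
    refine (((H.hasDerivAt_flux hs).const_mul ((n : ℝ) + 2)).sub
      ((hasDerivAt_pow (n + 2) s).const_mul (max (α + lam * φ 0) 0 ^ p))).congr_deriv ?_
    push_cast
    ring
  have hanti : AntitoneOn
      (fun s => (n + 2) * flux n φ s - max (α + lam * φ 0) 0 ^ p * s ^ (n + 2)) (Icc 0 R) := by
    refine antitoneOn_of_deriv_nonpos (convex_Icc 0 R) ?_ ?_ ?_
    · have := H.continuous_flux
      fun_prop
    · rw [interior_Icc]
      exact fun s hs => (hd s hs).differentiableAt.differentiableWithinAt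
    · rw [interior_Icc]
      intro s hs
      rw [(hd s hs).deriv]
      have hle : max (α + lam * φ s) 0 ^ p ≤ max (α + lam * φ 0) 0 ^ p :=
        monotone_posPart_rpow hp (H.antitoneOn hlam ⟨le_rfl, (hs.1.trans hs.2).le⟩
          ⟨hs.1.le, hs.2.le⟩ hs.1.le)
      have := pow_nonneg hs.1.le (n + 1)
      exact mul_nonpos_of_nonneg_of_nonpos (by positivity) (by linarith)
  have := hanti ⟨le_rfl, hr.1.trans hr.2⟩ hr hr.1
  simp only [flux_zero] at this
  simpa using this

/-- The logarithmic derivative `r m'(r) / m(r)` of the flux. -/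
def logSlope (n : ℕ) (p lam α : ℝ) (φ : ℝ → ℝ) (r : ℝ) : ℝ :=
  r ^ (n + 2) * max (α + lam * φ r) 0 ^ p / flux n φ r

theorem logSlope_nonneg (H : IsRadialProfile n R p lam α φ) {r : ℝ} (hr : r ∈ Icc 0 R) :
    0 ≤ logSlope n p lam α φ r :=
  div_nonneg (mul_nonneg (pow_nonneg hr.1 _) (posPart_rpow_nonneg _ _)) (H.flux_nonneg hr)

/-- The quantity `-r v'(r) / v(r)` with `v = α + λ φ`. -/
def invSlope (lam α : ℝ) (φ : ℝ → ℝ) (r : ℝ) : ℝ := -(lam * (r * deriv φ r)) / (α + lam * φ r)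

theorem hasDerivAt_invSlope (H : IsRadialProfile n R p lam α φ) {r : ℝ}
    (hr : r ∈ Ioo 0 R) (hv : 0 < α + lam * φ r) (hm : 0 < flux n φ r) :
    HasDerivAt (invSlope lam α φ)
      (invSlope lam α φ r * (logSlope n p lam α φ r + invSlope lam α φ r - n) / r) r := by
  have h := ((((hasDerivAt_id r).mul (hasDerivAt_deriv_of_contDiff_two H.contDiff r)).const_mul
    lam).neg).div (((hasDerivAt_of_contDiff_two H.contDiff r).const_mul lam).const_add α) hv.ne'
  refine h.congr_deriv ?_
  have hr0 : r ≠ 0 := hr.1.ne'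
  have hode := H.ode r hr
  have h2 : deriv (deriv φ) r = -(max (α + lam * φ r) 0) ^ p - (n + 1) / r * deriv φ r := by
    linarith
  have hd : deriv φ r ≠ 0 := by
    intro h0
    simp [flux, h0] at hm
  have hDq : logSlope n p lam α φ r = -r * max (α + lam * φ r) 0 ^ p / deriv φ r := by
    rw [logSlope, flux]
    field_simp
    ring
  rw [hDq, h2, invSlope]
  simp only [Pi.neg_apply, Pi.mul_apply, id_eq]
  field_simp
  ring

theorem hasDerivAt_logSlope (H : IsRadialProfile n R p lam α φ) {r : ℝ}
    (hr : r ∈ Ioo 0 R) (hv : 0 < α + lam * φ r) (hm : 0 < flux n φ r) :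
    HasDerivAt (logSlope n p lam α φ)
      (logSlope n p lam α φ r *
        (n + 2 - p * invSlope lam α φ r - logSlope n p lam α φ r) / r) r := by
  have hcont : Continuous fun s => α + lam * φ s :=
    continuous_const.add (continuous_const.mul H.contDiff.continuous)
  have hvd := ((hasDerivAt_of_contDiff_two H.contDiff r).const_mul lam).const_add α
  have hP : HasDerivAt (fun s => max (α + lam * φ s) 0 ^ p)
      (lam * deriv φ r * p * (α + lam * φ r) ^ (p - 1)) r := by
    refine (hvd.rpow_const (p := p) (Or.inl hv.ne')).congr_of_eventuallyEq ?_
    filter_upwards [hcont.continuousAt.eventually_const_lt hv] with s hs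
    rw [max_eq_left hs.le]
  have h := ((hasDerivAt_pow (n + 2) r).mul hP).div (H.hasDerivAt_flux hr) hm.ne'
  refine h.congr_deriv ?_
  have hr0 : r ≠ 0 := hr.1.ne'
  rw [logSlope, invSlope, Real.rpow_sub_one hv.ne']
  simp only [max_eq_left hv.le, show n + 2 - 1 = n + 1 by omega, Pi.mul_apply]
  set V := (α + lam * φ r) ^ p
  set v := α + lam * φ r
  set m := flux n φ r
  have hm' := hm.ne'
  have hv' := hv.ne'
  field_simp
  push_cast
  ring

theorem invSlope_nonneg (H : IsRadialProfile n R p lam α φ) (hlam : 0 ≤ lam) {r : ℝ}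
    (hr : r ∈ Ioc 0 R) (hv : 0 < α + lam * φ r) : 0 ≤ invSlope lam α φ r := by
  refine div_nonneg ?_ hv.le
  have := mul_nonneg hlam (mul_nonneg hr.1.le (neg_nonneg.2 (H.deriv_nonpos hr)))
  linarith

theorem eventually_sub_logSlope_le (H : IsRadialProfile n R p lam α φ) (hp : 1 < p)
    (hlam : 0 ≤ lam) (hR : 0 < R) (hc : 0 < flux n φ R) {ε : ℝ} (hε : 0 < ε) :
    ∀ᶠ r in nhdsWithin 0 (Ioi 0), (n : ℝ) + 2 - logSlope n p lam α φ r ≤ ε := by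
  have hv0 := H.center_pos hp hlam hR hc
  have hP0 : 0 < max (α + lam * φ 0) 0 ^ p := Real.rpow_pos_of_pos (lt_max_of_lt_left hv0) p
  have hcont : Continuous fun s => (n + 2) * max (α + lam * φ s) 0 ^ p := by
    have := (continuous_posPart_rpow hp).comp
      (continuous_const.add (continuous_const.mul H.contDiff.continuous) :
        Continuous fun s => α + lam * φ s)
    exact continuous_const.mul this
  have hlt : ((n : ℝ) + 2 - ε) * max (α + lam * φ 0) 0 ^ p
      < (n + 2) * max (α + lam * φ 0) 0 ^ p := by
    gcongr
    linarith
  have h1 : ∀ᶠ s in nhdsWithin (0 : ℝ) (Ioi 0), ((n : ℝ) + 2 - ε) * max (α + lam * φ 0) 0 ^ p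
      < (n + 2) * max (α + lam * φ s) 0 ^ p :=
    nhdsWithin_le_nhds (hcont.continuousAt.eventually_const_lt hlt)
  have h2 : ∀ᶠ s in nhdsWithin (0 : ℝ) (Ioi 0), s ∈ Ioo 0 R := Ioo_mem_nhdsGT hR
  filter_upwards [h1, h2] with s hs1 hs2
  have hm := H.flux_pos hp hlam hc ⟨hs2.1, hs2.2.le⟩
  have hle := H.flux_le hp hlam ⟨hs2.1.le, hs2.2.le⟩
  have hpow := pow_pos hs2.1 (n + 2)
  suffices (n : ℝ) + 2 - ε ≤ logSlope n p lam α φ s by linarith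
  rw [logSlope, le_div_iff₀ hm]
  rcases le_or_gt ((n : ℝ) + 2 - ε) 0 with hneg | hpos
  · exact (mul_nonpos_of_nonpos_of_nonneg hneg hm.le).trans
      (mul_nonneg hpow.le (posPart_rpow_nonneg _ _))
  · have h3 : ((n : ℝ) + 2) * (((n : ℝ) + 2 - ε) * flux n φ s)
        ≤ ((n : ℝ) + 2) * (s ^ (n + 2) * max (α + lam * φ s) 0 ^ p) := by
      calc ((n : ℝ) + 2) * (((n : ℝ) + 2 - ε) * flux n φ s)
          = ((n : ℝ) + 2 - ε) * (((n : ℝ) + 2) * flux n φ s) := by ring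
        _ ≤ ((n : ℝ) + 2 - ε) * (max (α + lam * φ 0) 0 ^ p * s ^ (n + 2)) := by gcongr
        _ = (((n : ℝ) + 2 - ε) * max (α + lam * φ 0) 0 ^ p) * s ^ (n + 2) := by ring
        _ ≤ ((n + 2) * max (α + lam * φ s) 0 ^ p) * s ^ (n + 2) := by gcongr
        _ = _ := by ring
    exact le_of_mul_le_mul_left h3 (by positivity)

theorem logSlope_drift_nonpos (H : IsRadialProfile n R p lam α φ) (hp : 1 < p)
    (hpn : p * n < n + 2) (hlam : 0 ≤ lam) (hc : 0 < flux n φ R) {b : ℝ} (hb : b ∈ Ioo 0 R)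
    (hv : 0 < α + lam * φ b) :
    (n : ℝ) + 2 - p * invSlope lam α φ b - logSlope n p lam α φ b ≤ 0 := by
  have hR : 0 < R := hb.1.trans hb.2
  set δ : ℝ := 2 - (p - 1) * n with hδ
  have hδ0 : 0 < δ := by rw [hδ]; linarith
  refine le_of_forall_pos_le_add fun ε' hε' => ?_
  rw [zero_add]
  set ε := min ε' δ with hεd
  have hε : 0 < ε := lt_min hε' hδ0
  refine le_trans ?_ (min_le_left ε' δ)
  have h2 : ∀ᶠ s in nhdsWithin (0 : ℝ) (Ioi 0), s ∈ Ioo 0 b := Ioo_mem_nhdsGT hb.1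
  obtain ⟨a, ha1, ha2⟩ := ((H.eventually_sub_logSlope_le hp hlam hR hc hε).and h2).exists
  have hvall : ∀ x ∈ Icc a b, 0 < α + lam * φ x := fun x hx =>
    hv.trans_le (H.antitoneOn hlam ⟨ha2.1.le.trans hx.1, hx.2.trans hb.2.le⟩
      ⟨hb.1.le, hb.2.le⟩ hx.2)
  have hxR : ∀ x ∈ Icc a b, x ∈ Ioo 0 R := fun x hx =>
    ⟨ha2.1.trans_le hx.1, hx.2.trans_lt hb.2⟩
  have hfl : ∀ x ∈ Icc a b, 0 < flux n φ x := fun x hx =>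
    H.flux_pos hp hlam hc ⟨(hxR x hx).1, (hxR x hx).2.le⟩
  have hder : ∀ x ∈ Icc a b, HasDerivAt
      (fun x => (n : ℝ) + 2 - p * invSlope lam α φ x - logSlope n p lam α φ x)
      (-(p * (invSlope lam α φ x * (logSlope n p lam α φ x + invSlope lam α φ x - n) / x)) -
        logSlope n p lam α φ x *
          (n + 2 - p * invSlope lam α φ x - logSlope n p lam α φ x) / x) x := fun x hx =>
    (((H.hasDerivAt_invSlope (hxR x hx) (hvall x hx) (hfl x hx)).const_mul p).const_sub _).sub
      (H.hasDerivAt_logSlope (hxR x hx) (hvall x hx) (hfl x hx))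
  refine image_le_of_deriv_right_lt_deriv_boundary (a := a) (b := b) (B := fun _ => ε)
    (B' := fun _ => 0) (fun x hx => (hder x hx).continuousAt.continuousWithinAt)
    (fun x hx => (hder x ⟨hx.1, hx.2.le⟩).hasDerivWithinAt) ?_ (fun x => hasDerivAt_const x ε) ?_
    ⟨ha2.2.le, le_rfl⟩
  · have hq := H.invSlope_nonneg hlam ⟨ha2.1, (ha2.2.trans hb.2).le⟩
      (hvall a ⟨le_rfl, ha2.2.le⟩)
    have := mul_nonneg (by linarith : (0 : ℝ) ≤ p) hq
    linarith
  · intro x hx heq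
    have hx' : x ∈ Icc a b := ⟨hx.1, hx.2.le⟩
    have hx0 := (hxR x hx').1
    have hq := H.invSlope_nonneg hlam ⟨hx0, (hxR x hx').2.le⟩ (hvall x hx')
    have hD : 0 < logSlope n p lam α φ x :=
      div_pos (mul_pos (pow_pos hx0 _)
        (Real.rpow_pos_of_pos (lt_max_of_lt_left (hvall x hx')) p)) (hfl x hx')
    rw [heq]
    set q := invSlope lam α φ x
    set D := logSlope n p lam α φ x
    have hG : 0 ≤ D + q - n := by
      rcases le_or_gt (n : ℝ) q with h | h
      · linarith
      · have h1 : (p - 1) * q ≤ (p - 1) * n := mul_le_mul_of_nonneg_left h.le (by linarith)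
        have h2 : ε ≤ δ := min_le_right _ _
        linarith
    have h1 : 0 ≤ p * (q * (D + q - n) / x) := by positivity
    have h2 : 0 < D * ε / x := by positivity
    linarith

theorem antitoneOn_logSlope (H : IsRadialProfile n R p lam α φ) (hp : 1 < p)
    (hpn : p * n < n + 2) (hlam : 0 ≤ lam) (hc : 0 < flux n φ R) :
    AntitoneOn (logSlope n p lam α φ) (Ioo 0 R) := by
  intro a ha b hb hab
  rcases le_or_gt (α + lam * φ b) 0 with hv | hv
  · have : logSlope n p lam α φ b = 0 := by
      rw [logSlope, max_eq_right hv, Real.zero_rpow (by linarith)]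
      simp
    rw [this]
    exact H.logSlope_nonneg ⟨ha.1.le, ha.2.le⟩
  have hxR : ∀ x ∈ Icc a b, x ∈ Ioo 0 R := fun x hx => ⟨ha.1.trans_le hx.1, hx.2.trans_lt hb.2⟩
  have hvall : ∀ x ∈ Icc a b, 0 < α + lam * φ x := fun x hx =>
    hv.trans_le (H.antitoneOn hlam ⟨(hxR x hx).1.le, (hxR x hx).2.le⟩ ⟨hb.1.le, hb.2.le⟩ hx.2)
  have hfl : ∀ x ∈ Icc a b, 0 < flux n φ x := fun x hx =>
    H.flux_pos hp hlam hc ⟨(hxR x hx).1, (hxR x hx).2.le⟩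
  have hder := fun x hx => H.hasDerivAt_logSlope (hxR x hx) (hvall x hx) (hfl x hx)
  have hanti : AntitoneOn (logSlope n p lam α φ) (Icc a b) := by
    refine antitoneOn_of_deriv_nonpos (convex_Icc a b)
      (fun x hx => (hder x hx).continuousAt.continuousWithinAt) ?_ ?_
    · intro x hx
      exact (hder x (interior_subset hx)).differentiableAt.differentiableWithinAt
    · intro x hx
      have hx' := interior_subset hx
      rw [(hder x hx').deriv]
      refine div_nonpos_of_nonpos_of_nonneg (mul_nonpos_of_nonneg_of_nonpos
        (H.logSlope_nonneg ⟨(hxR x hx').1.le, (hxR x hx').2.le⟩)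
        (H.logSlope_drift_nonpos hp hpn hlam hc (hxR x hx') (hvall x hx'))) (hxR x hx').1.le
  exact hanti ⟨le_rfl, hab⟩ ⟨hab, le_rfl⟩ hab

theorem flux_ratio_mono (H : IsRadialProfile n R p lam α φ) (hp : 1 < p)
    (hpn : p * n < n + 2) (hlam : 0 ≤ lam) (hc : 0 < flux n φ R) {τ : ℝ} (hτ : τ ∈ Ioc 0 1)
    {a b : ℝ} (ha : 0 < a) (hab : a ≤ b) (hb : b ≤ R) :
    flux n φ (τ * a) * flux n φ b ≤ flux n φ (τ * b) * flux n φ a := by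
  have hpos := fun r (hr : r ∈ Ioc 0 R) => H.flux_pos hp hlam hc hr
  have hτm : ∀ r ∈ Ioc 0 R, τ * r ∈ Ioc 0 R := fun r hr =>
    ⟨mul_pos hτ.1 hr.1, (mul_le_of_le_one_left hr.1.le hτ.2).trans hr.2⟩
  have hd : ∀ r ∈ Ioo 0 R, HasDerivAt
      (fun r => Real.log (flux n φ r) - Real.log (flux n φ (τ * r)))
      ((logSlope n p lam α φ r - logSlope n p lam α φ (τ * r)) / r) r := by
    intro r hr
    have hr' : r ∈ Ioc 0 R := ⟨hr.1, hr.2.le⟩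
    have hτr : τ * r ∈ Ioo 0 R :=
      ⟨(hτm r hr').1, (mul_le_of_le_one_left hr.1.le hτ.2).trans_lt hr.2⟩
    have h1 := (H.hasDerivAt_flux hr).log (hpos r hr').ne'
    have hlin : HasDerivAt (fun r : ℝ => τ * r) τ r := by
      simpa using (hasDerivAt_id r).const_mul τ
    have h2 := ((H.hasDerivAt_flux hτr).comp r hlin).log (hpos _ (hτm r hr')).ne'
    refine (h1.sub h2).congr_deriv ?_
    have e1 := (hpos r hr').ne'
    have e2 := (hpos _ (hτm r hr')).ne'
    have e3 := hr.1.ne'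
    simp only [logSlope, Function.comp_apply]
    field_simp
    ring
  have hanti : AntitoneOn (fun r => Real.log (flux n φ r) - Real.log (flux n φ (τ * r)))
      (Ioc 0 R) := by
    refine antitoneOn_of_deriv_nonpos (convex_Ioc 0 R) ?_ ?_ ?_
    · refine ContinuousOn.sub (H.continuous_flux.continuousOn.log fun r hr => (hpos r hr).ne') ?_
      exact (H.continuous_flux.comp (continuous_const.mul continuous_id)).continuousOn.log
        fun r hr => (hpos _ (hτm r hr)).ne'
    · rw [interior_Ioc]
      exact fun r hr => (hd r hr).differentiableAt.differentiableWithinAt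
    · rw [interior_Ioc]
      intro r hr
      rw [(hd r hr).deriv]
      have hle := mul_le_of_le_one_left hr.1.le hτ.2
      refine div_nonpos_of_nonpos_of_nonneg (sub_nonpos.2 ?_) hr.1.le
      exact H.antitoneOn_logSlope hp hpn hlam hc ⟨mul_pos hτ.1 hr.1, hle.trans_lt hr.2⟩ hr hle
  have haR : a ∈ Ioc 0 R := ⟨ha, hab.trans hb⟩
  have hbR : b ∈ Ioc 0 R := ⟨ha.trans_le hab, hb⟩
  have h := hanti haR hbR hab
  simp only at h
  have hlog : Real.log (flux n φ (τ * a) * flux n φ b) ≤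
      Real.log (flux n φ (τ * b) * flux n φ a) := by
    rw [Real.log_mul (hpos _ (hτm a haR)).ne' (hpos b hbR).ne',
      Real.log_mul (hpos _ (hτm b hbR)).ne' (hpos a haR).ne']
    linarith
  exact (Real.log_le_log_iff (mul_pos (hpos _ (hτm a haR)) (hpos b hbR))
    (mul_pos (hpos _ (hτm b hbR)) (hpos a haR))).1 hlog

end IsRadialProfile

theorem radial_ode_unique {n : ℕ} {p lam ρ : ℝ} (hp : 1 < p) (hlam : 0 ≤ lam) {a b : ℝ → ℝ}
    (ha : ContDiff ℝ 2 a) (hb : ContDiff ℝ 2 b) (h0 : a 0 = b 0) (h0' : deriv a 0 = deriv b 0)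
    (hodea : ∀ r ∈ Ioo 0 ρ, deriv (deriv a) r + (n + 1) / r * deriv a r = -(lam * max (a r) 0 ^ p))
    (hodeb : ∀ r ∈ Ioo 0 ρ, deriv (deriv b) r + (n + 1) / r * deriv b r = -(lam * max (b r) 0 ^ p))
    {r : ℝ} (hr : r ∈ Icc 0 ρ) : deriv a r = deriv b r := by
  obtain ⟨Ca, hCa⟩ := isCompact_Icc.bddAbove_image (K := Icc 0 ρ) ha.continuous.continuousOn
  obtain ⟨Cb, hCb⟩ := isCompact_Icc.bddAbove_image (K := Icc 0 ρ) hb.continuous.continuousOn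
  set C := max 0 (max Ca Cb) with hC
  have hC0 : 0 ≤ C := le_max_left _ _
  have hCa' : ∀ s ∈ Icc 0 ρ, a s ≤ C := fun s hs =>
    (hCa (mem_image_of_mem _ hs)).trans ((le_max_left _ _).trans (le_max_right _ _))
  have hCb' : ∀ s ∈ Icc 0 ρ, b s ≤ C := fun s hs =>
    (hCb (mem_image_of_mem _ hs)).trans ((le_max_right _ _).trans (le_max_right _ _))
  set L := p * C ^ (p - 1) with hL
  have hL0 : 0 ≤ L := by positivity
  set K := 1 + lam * L with hK
  have hd : ∀ s, HasDerivAt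
      (fun s => ((a s - b s) ^ 2 + (deriv a s - deriv b s) ^ 2) * Real.exp (-(K * s)))
      ((2 * (a s - b s) * (deriv a s - deriv b s) +
        2 * (deriv a s - deriv b s) * (deriv (deriv a) s - deriv (deriv b) s) -
        K * ((a s - b s) ^ 2 + (deriv a s - deriv b s) ^ 2)) * Real.exp (-(K * s))) s := by
    intro s
    have h1 := ((hasDerivAt_of_contDiff_two ha s).sub (hasDerivAt_of_contDiff_two hb s)).pow 2
    have h2 := ((hasDerivAt_deriv_of_contDiff_two ha s).sub
      (hasDerivAt_deriv_of_contDiff_two hb s)).pow 2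
    have h3 : HasDerivAt (fun s : ℝ => -(K * s)) (-K) s := by
      simpa using (hasDerivAt_id s).const_mul (-K)
    refine ((h1.add h2).mul h3.exp).congr_deriv ?_
    simp only [Pi.sub_apply, Pi.pow_apply, Pi.add_apply]
    push_cast
    ring
  have hanti : AntitoneOn
      (fun s => ((a s - b s) ^ 2 + (deriv a s - deriv b s) ^ 2) * Real.exp (-(K * s)))
      (Icc 0 ρ) := by
    refine antitoneOn_of_deriv_nonpos (convex_Icc 0 ρ)
      (fun s _ => (hd s).continuousAt.continuousWithinAt)
      (fun s _ => (hd s).differentiableAt.differentiableWithinAt) ?_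
    rw [interior_Icc]
    intro s hs
    rw [(hd s).deriv]
    refine mul_nonpos_of_nonpos_of_nonneg ?_ (Real.exp_pos _).le
    have hs' : s ∈ Icc 0 ρ := ⟨hs.1.le, hs.2.le⟩
    have hP := abs_posPart_rpow_sub_le hp hC0 (hCa' s hs') (hCb' s hs')
    have e1 : deriv (deriv a) s - deriv (deriv b) s = -((n + 1) / s * (deriv a s - deriv b s)) -
        lam * (max (a s) 0 ^ p - max (b s) 0 ^ p) := by
      linarith [hodea s hs, hodeb s hs]
    rw [e1]
    set u := a s - b s
    set w := deriv a s - deriv b s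
    set d := max (a s) 0 ^ p - max (b s) 0 ^ p
    have hdrop : 0 ≤ (n + 1) / s * (w * w) :=
      mul_nonneg (div_nonneg (by positivity) hs.1.le) (mul_self_nonneg w)
    have h1 : -(w * d) ≤ |w| * (L * |u|) := by
      calc -(w * d) ≤ |w * d| := neg_le_abs _
        _ = |w| * |d| := abs_mul _ _
        _ ≤ _ := by gcongr
    have h2 : u * w ≤ |w| * |u| := by
      rw [mul_comm, ← abs_mul]
      exact le_abs_self _
    have h3 : 2 * (|w| * |u|) ≤ u ^ 2 + w ^ 2 := by
      nlinarith [sq_nonneg (|w| - |u|), sq_abs w, sq_abs u]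
    have h4 := mul_le_mul_of_nonneg_left h1 hlam
    have hK0 : 0 ≤ K := by positivity
    have h5 := mul_le_mul_of_nonneg_left h3 hK0
    have h6 : K * (2 * (|w| * |u|)) = 2 * (|w| * |u|) + 2 * (lam * (|w| * (L * |u|))) := by
      rw [hK]; ring
    linarith
  have h := hanti ⟨le_rfl, hr.1.trans hr.2⟩ hr hr.1
  simp only [h0, h0', sub_self] at h
  have h2 : (a r - b r) ^ 2 + (deriv a r - deriv b r) ^ 2 ≤ 0 := by
    by_contra! h3
    have := mul_pos h3 (Real.exp_pos (-(K * r)))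
    simp at h
    linarith
  have h3 : (deriv a r - deriv b r) ^ 2 = 0 :=
    le_antisymm (by linarith [sq_nonneg (a r - b r)]) (sq_nonneg _)
  exact sub_eq_zero.1 (pow_eq_zero_iff (two_ne_zero) |>.1 h3)

namespace IsRadialProfile

variable {n : ℕ} {R p lam₁ lam₂ α₁ α₂ : ℝ} {φ₁ φ₂ : ℝ → ℝ}

theorem exists_flux_scaling (H₁ : IsRadialProfile n R p lam₁ α₁ φ₁)
    (H₂ : IsRadialProfile n R p lam₂ α₂ φ₂) (hp : 1 < p) (hlam₁ : 0 < lam₁) (hlam₂ : 0 < lam₂)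
    (hR : 0 < R) (hc₁ : 0 < flux n φ₁ R) (hc₂ : 0 < flux n φ₂ R) :
    ∃ κ σ : ℝ, 0 < κ ∧ 0 < σ ∧ σ ^ 2 * lam₁ = κ ^ (p - 1) * lam₂ ∧
      ∀ r ∈ Icc 0 R, σ * r ≤ R → flux n φ₂ r * σ ^ (n + 2) = κ ^ p * flux n φ₁ (σ * r) := by
  have hv₁ := H₁.center_pos hp hlam₁.le hR hc₁
  have hv₂ := H₂.center_pos hp hlam₂.le hR hc₂
  set κ := (α₂ + lam₂ * φ₂ 0) / (α₁ + lam₁ * φ₁ 0) with hκd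
  have hκ : 0 < κ := div_pos hv₂ hv₁
  have hκp : 0 < κ ^ (p - 1) := Real.rpow_pos_of_pos hκ _
  set σ := √(κ ^ (p - 1) * lam₂ / lam₁) with hσd
  have hσ : 0 < σ := Real.sqrt_pos.2 (by positivity)
  have hσ2 : σ ^ 2 * lam₁ = κ ^ (p - 1) * lam₂ := by
    rw [hσd, Real.sq_sqrt (by positivity)]
    field_simp
  refine ⟨κ, σ, hκ, hσ, hσ2, fun r hr hσr => ?_⟩
  set a : ℝ → ℝ := fun r => α₂ + lam₂ * φ₂ r with had
  set b : ℝ → ℝ := fun r => κ * (α₁ + lam₁ * φ₁ (σ * r)) with hbd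
  have hlin : ∀ s : ℝ, HasDerivAt (fun s => σ * s) σ s := fun s => by
    simpa using (hasDerivAt_id s).const_mul σ
  have ha' : deriv a = fun s => lam₂ * deriv φ₂ s := funext fun s =>
    (((hasDerivAt_of_contDiff_two H₂.contDiff s).const_mul lam₂).const_add α₂).deriv
  have hb' : deriv b = fun s => κ * (lam₁ * (deriv φ₁ (σ * s) * σ)) := funext fun s =>
    (((((hasDerivAt_of_contDiff_two H₁.contDiff (σ * s)).comp s (hlin s)).const_mul
      lam₁).const_add α₁).const_mul κ).deriv
  have ha'' : ∀ s, deriv (deriv a) s = lam₂ * deriv (deriv φ₂) s := fun s => by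
    rw [ha']
    exact ((hasDerivAt_deriv_of_contDiff_two H₂.contDiff s).const_mul lam₂).deriv
  have hb'' : ∀ s, deriv (deriv b) s = κ * (lam₁ * (deriv (deriv φ₁) (σ * s) * σ * σ)) :=
    fun s => by
      rw [hb']
      exact (((((hasDerivAt_deriv_of_contDiff_two H₁.contDiff (σ * s)).comp s
        (hlin s)).mul_const σ).const_mul lam₁).const_mul κ).deriv
  have hκσ : κ * σ ^ 2 * lam₁ = κ ^ p * lam₂ := by
    rw [mul_assoc, hσ2, Real.rpow_sub_one hκ.ne']
    field_simp
  have key : deriv a r = deriv b r := by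
    refine radial_ode_unique (n := n) (ρ := r) hp hlam₂.le (p := p) (lam := lam₂) ?_ ?_ ?_ ?_
      ?_ ?_ ⟨hr.1, le_rfl⟩
    · exact contDiff_const.add (contDiff_const.mul H₂.contDiff)
    · exact contDiff_const.mul (contDiff_const.add (contDiff_const.mul
        (H₁.contDiff.comp (contDiff_const.mul contDiff_id))))
    · simp only [had, hbd, mul_zero]
      rw [hκd]
      field_simp
    · rw [ha', hb']
      simp [H₁.deriv_zero, H₂.deriv_zero]
    · intro s hs
      rw [ha'', ha']
      have := H₂.ode s ⟨hs.1, hs.2.trans_le hr.2⟩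
      simp only [had]
      linear_combination lam₂ * this
    · intro s hs
      have hσs : σ * s ∈ Ioo 0 R :=
        ⟨mul_pos hσ hs.1, (mul_lt_mul_of_pos_left hs.2 hσ).trans_le hσr⟩
      have := H₁.ode _ hσs
      have hs0 := hs.1.ne'
      have hmax : max (κ * (α₁ + lam₁ * φ₁ (σ * s))) 0 ^ p =
          κ ^ p * max (α₁ + lam₁ * φ₁ (σ * s)) 0 ^ p := by
        rw [← Real.mul_rpow hκ.le (le_max_right _ _), mul_max_of_nonneg _ _ hκ.le, mul_zero]
      rw [hb'', hb']
      simp only [hbd]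
      rw [hmax]
      have e : ((n : ℝ) + 1) / s = σ * ((n + 1) / (σ * s)) := by field_simp
      rw [e]
      linear_combination κ * lam₁ * σ ^ 2 * this - max (α₁ + lam₁ * φ₁ (σ * s)) 0 ^ p * hκσ
  rw [ha', hb'] at key
  simp only at key
  simp only [flux]
  have h1 : lam₂ * (-(r ^ (n + 1) * deriv φ₂ r) * σ ^ (n + 2)) =
      lam₂ * (κ ^ p * -((σ * r) ^ (n + 1) * deriv φ₁ (σ * r))) := by
    linear_combination (-(r ^ (n + 1) * σ ^ (n + 2))) * key -
      (r ^ (n + 1) * σ ^ (n + 1)) * deriv φ₁ (σ * r) * hκσ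
  exact mul_left_cancel₀ hlam₂.ne' h1

theorem flux_le_flux_of_pos (H₁ : IsRadialProfile n R p lam₁ α₁ φ₁)
    (H₂ : IsRadialProfile n R p lam₂ α₂ φ₂) (hp : 1 < p) (hpn : p * n < n + 2) (hlam₁ : 0 < lam₁)
    (hlt : lam₁ < lam₂) (hR : 0 < R) (hc : 0 < flux n φ₁ R) (heq : flux n φ₁ R = flux n φ₂ R)
    {s : ℝ} (hs : s ∈ Icc 0 R) : flux n φ₁ s ≤ flux n φ₂ s := by
  have hlam₂ := hlam₁.trans hlt
  have hc₂ : 0 < flux n φ₂ R := heq ▸ hc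
  obtain ⟨κ, σ, hκ, hσ, hκσ, hscale⟩ := H₁.exists_flux_scaling H₂ hp hlam₁ hlam₂ hR hc hc₂
  have hRR : R ∈ Icc 0 R := ⟨hR.le, le_rfl⟩
  have hσ1 : 1 < σ := by
    by_contra! hle
    have hσR : σ * R ≤ R := mul_le_of_le_one_left hR.le hle
    have h1 := hscale R hRR hσR
    have h2 := H₁.monotoneOn_flux ⟨by positivity, hσR⟩ hRR hσR
    have h3 : σ ^ (n + 2) ≤ κ ^ p := by
      rw [← heq] at h1
      have := mul_le_mul_of_nonneg_left h2 (Real.rpow_nonneg hκ.le p)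
      rw [← h1, mul_comm] at this
      exact le_of_mul_le_mul_right this hc
    have h4 : κ ^ (p - 1) < σ ^ 2 := by
      have h5 : κ ^ (p - 1) * lam₁ < κ ^ (p - 1) * lam₂ :=
        mul_lt_mul_of_pos_left hlt (Real.rpow_pos_of_pos hκ _)
      rw [← hκσ] at h5
      exact lt_of_mul_lt_mul_right h5 hlam₁.le
    have l3 := Real.log_le_log (by positivity) h3
    have l4 := Real.log_lt_log (Real.rpow_pos_of_pos hκ _) h4
    rw [Real.log_pow, Real.log_rpow hκ] at l3
    rw [Real.log_pow, Real.log_rpow hκ] at l4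
    push_cast at l3 l4
    have l5 := Real.log_nonpos hσ.le hle
    have e1 := mul_le_mul_of_nonneg_left l3 (by linarith : 0 ≤ p - 1)
    have e2 := mul_lt_mul_of_pos_left l4 (by linarith : 0 < p)
    have e3 : 0 ≤ (p * n - (n + 2)) * Real.log σ :=
      mul_nonneg_of_nonpos_of_nonpos (by linarith) l5
    nlinarith
  have haR : R / σ < R := div_lt_self hR hσ1
  have ha0 : 0 < R / σ := div_pos hR hσ
  have hfl : 0 < flux n φ₂ (R / σ) := H₂.flux_pos hp hlam₂.le hc₂ ⟨ha0, haR.le⟩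
  rcases hs.1.eq_or_lt with h0 | h0
  · rw [← h0, flux_zero, flux_zero]
  have hsσ : s / σ ∈ Icc 0 R := ⟨by positivity, (div_le_self hs.1 hσ1.le).trans hs.2⟩
  have e1 := hscale (s / σ) hsσ (by rw [mul_div_cancel₀ _ hσ.ne']; exact hs.2)
  have e2 := hscale (R / σ) ⟨ha0.le, haR.le⟩ (by rw [mul_div_cancel₀ _ hσ.ne'])
  rw [mul_div_cancel₀ _ hσ.ne'] at e1 e2
  have hmono := H₂.flux_ratio_mono hp hpn hlam₂.le hc₂ (τ := s / R)
    ⟨div_pos h0 hR, (div_le_one hR).2 hs.2⟩ ha0 haR.le le_rfl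
  rw [show s / R * (R / σ) = s / σ by field_simp, show s / R * R = s by field_simp, ← heq] at hmono
  have hκp : 0 < κ ^ p := Real.rpow_pos_of_pos hκ p
  have e3 : flux n φ₁ s * flux n φ₂ (R / σ) = flux n φ₂ (s / σ) * flux n φ₁ R := by
    refine mul_left_cancel₀ (mul_pos hκp (pow_pos hσ (n + 2))).ne' ?_
    linear_combination (-(σ ^ (n + 2) * flux n φ₂ (R / σ))) * e1 +
      (σ ^ (n + 2) * flux n φ₂ (s / σ)) * e2
  rw [← e3] at hmono
  exact le_of_mul_le_mul_right hmono hfl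

theorem flux_le_flux_of_zero (H₁ : IsRadialProfile n R p 0 α₁ φ₁)
    (H₂ : IsRadialProfile n R p lam₂ α₂ φ₂) (hp : 1 < p) (hlam₂ : 0 ≤ lam₂)
    (heq : flux n φ₁ R = flux n φ₂ R) {s : ℝ} (hs : s ∈ Icc 0 R) :
    flux n φ₁ s ≤ flux n φ₂ s := by
  by_contra! hlt
  have hs0 : 0 < s := by
    rcases hs.1.eq_or_lt with h | h
    · rw [← h, flux_zero, flux_zero] at hlt
      exact absurd hlt (lt_irrefl _)
    · exact h
  have hsR : s < R := by
    rcases hs.2.eq_or_lt with h | h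
    · rw [h, heq] at hlt
      exact absurd hlt (lt_irrefl _)
    · exact h
  have hcont : Continuous fun r => flux n φ₂ r - flux n φ₁ r :=
    H₂.continuous_flux.sub H₁.continuous_flux
  have hd : ∀ r ∈ Ioo 0 R, HasDerivAt (fun r => flux n φ₂ r - flux n φ₁ r)
      (r ^ (n + 1) * (max (α₂ + lam₂ * φ₂ r) 0 ^ p - max α₁ 0 ^ p)) r := fun r hr => by
    refine ((H₂.hasDerivAt_flux hr).sub (H₁.hasDerivAt_flux hr)).congr_deriv ?_
    rw [zero_mul, add_zero]
    ring
  obtain ⟨x, hx, hxe⟩ := exists_hasDerivAt_eq_slope _ _ hs0 hcont.continuousOn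
    fun r hr => hd r ⟨hr.1, hr.2.trans hsR⟩
  obtain ⟨y, hy, hye⟩ := exists_hasDerivAt_eq_slope _ _ hsR hcont.continuousOn
    fun r hr => hd r ⟨hs0.trans hr.1, hr.2⟩
  have hy0 := hs0.trans hy.1
  have hx' : max (α₂ + lam₂ * φ₂ x) 0 ^ p - max α₁ 0 ^ p < 0 := by
    refine neg_of_mul_neg_right (a := x ^ (n + 1)) ?_ (pow_nonneg hx.1.le _)
    rw [hxe, flux_zero, flux_zero]
    exact div_neg_of_neg_of_pos (by linarith) (by linarith)
  have hy' : 0 < max (α₂ + lam₂ * φ₂ y) 0 ^ p - max α₁ 0 ^ p := by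
    refine pos_of_mul_pos_right (a := y ^ (n + 1)) ?_ (pow_nonneg hy0.le _)
    rw [hye, heq]
    exact div_pos (by linarith) (by linarith)
  have := monotone_posPart_rpow hp (H₂.antitoneOn hlam₂ ⟨hx.1.le, (hx.2.trans hsR).le⟩
    ⟨hy0.le, hy.2.le⟩ (hx.2.trans hy.1).le)
  simp only at this
  linarith

theorem flux_le_flux (H₁ : IsRadialProfile n R p lam₁ α₁ φ₁)
    (H₂ : IsRadialProfile n R p lam₂ α₂ φ₂) (hp : 1 < p) (hpn : p * n < n + 2) (hlam₁ : 0 ≤ lam₁)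
    (hlt : lam₁ < lam₂) (hR : 0 < R) (hc : 0 < flux n φ₁ R) (heq : flux n φ₁ R = flux n φ₂ R)
    {s : ℝ} (hs : s ∈ Icc 0 R) : flux n φ₁ s ≤ flux n φ₂ s := by
  rcases hlam₁.eq_or_lt with h | h
  · subst h
    exact H₁.flux_le_flux_of_zero H₂ hp hlt.le heq hs
  · exact H₁.flux_le_flux_of_pos H₂ hp hpn h hlt hR hc heq hs

theorem not_deriv_eqOn (H₁ : IsRadialProfile n R p lam₁ α₁ φ₁)
    (H₂ : IsRadialProfile n R p lam₂ α₂ φ₂) (hp : 1 < p) (hlam₁ : 0 ≤ lam₁) (hlt : lam₁ < lam₂)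
    (hR : 0 < R) (hc : 0 < flux n φ₁ R) (heq : flux n φ₁ R = flux n φ₂ R) :
    ¬ EqOn (deriv φ₁) (deriv φ₂) (Ioo 0 R) := by
  intro hE
  have hlam₂ := hlam₁.trans hlt.le
  have hv₁ := H₁.center_pos hp hlam₁ hR hc
  have hv₂ := H₂.center_pos hp hlam₂ hR (heq ▸ hc)
  have hc₁ : Continuous fun s => α₁ + lam₁ * φ₁ s :=
    continuous_const.add (continuous_const.mul H₁.contDiff.continuous)
  have hc₂ : Continuous fun s => α₂ + lam₂ * φ₂ s :=
    continuous_const.add (continuous_const.mul H₂.contDiff.continuous)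
  have hev : ∀ᶠ s in nhdsWithin (0 : ℝ) (Ioi 0),
      (0 < α₁ + lam₁ * φ₁ s ∧ 0 < α₂ + lam₂ * φ₂ s) ∧ s ∈ Ioo 0 R :=
    Filter.Eventually.and (nhdsWithin_le_nhds ((hc₁.continuousAt.eventually_const_lt hv₁).and
      (hc₂.continuousAt.eventually_const_lt hv₂))) (Ioo_mem_nhdsGT hR)
  obtain ⟨δ, hδ, hsub⟩ := mem_nhdsGT_iff_exists_Ioo_subset.1 hev
  have hδ0 : 0 < δ := hδ
  have hveq : ∀ s ∈ Ioo 0 δ, α₁ + lam₁ * φ₁ s = α₂ + lam₂ * φ₂ s := by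
    intro s hs
    obtain ⟨⟨h1, h2⟩, hsR⟩ := hsub hs
    have hfl : flux n φ₁ =ᶠ[nhds s] flux n φ₂ := by
      filter_upwards [isOpen_Ioo.mem_nhds hsR] with t ht
      rw [flux, flux, hE ht]
    have hd := hfl.deriv_eq
    rw [(H₁.hasDerivAt_flux hsR).deriv, (H₂.hasDerivAt_flux hsR).deriv] at hd
    have h3 := mul_left_cancel₀ (pow_pos hs.1 (n + 1)).ne' hd
    rw [max_eq_left h1.le, max_eq_left h2.le] at h3
    exact (Real.rpow_left_inj h1.le h2.le (by linarith)).1 h3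
  have hs : δ / 2 ∈ Ioo 0 δ := ⟨by linarith, by linarith⟩
  have hsR := (hsub hs).2
  have hv : (fun s => α₁ + lam₁ * φ₁ s) =ᶠ[nhds (δ / 2)] fun s => α₂ + lam₂ * φ₂ s := by
    filter_upwards [isOpen_Ioo.mem_nhds hs] with t ht using hveq t ht
  have hd₁ := ((hasDerivAt_of_contDiff_two H₁.contDiff (δ / 2)).const_mul lam₁).const_add α₁
  have hd₂ := ((hasDerivAt_of_contDiff_two H₂.contDiff (δ / 2)).const_mul lam₂).const_add α₂
  have h5 := hd₁.unique (hd₂.congr_of_eventuallyEq hv)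
  rw [← hE hsR] at h5
  have h6 : deriv φ₁ (δ / 2) = 0 := by
    have : (lam₂ - lam₁) * deriv φ₁ (δ / 2) = 0 := by linarith
    exact (mul_eq_zero.1 this).resolve_left (by linarith)
  have h7 := H₁.flux_pos hp hlam₁ hc ⟨hsR.1, hsR.2.le⟩
  rw [flux, h6] at h7
  simp at h7

theorem energy_lt (H₁ : IsRadialProfile n R p lam₁ α₁ φ₁)
    (H₂ : IsRadialProfile n R p lam₂ α₂ φ₂) (hp : 1 < p) (hpn : p * n < n + 2) (hlam₁ : 0 ≤ lam₁)
    (hlt : lam₁ < lam₂) (hR : 0 < R) (hc : 0 < flux n φ₁ R) (heq : flux n φ₁ R = flux n φ₂ R) :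
    ∫ r in (0 : ℝ)..R, r ^ (n + 1) * deriv φ₁ r ^ 2 <
      ∫ r in (0 : ℝ)..R, r ^ (n + 1) * deriv φ₂ r ^ 2 := by
  have hcont : ∀ {φ : ℝ → ℝ}, ContDiff ℝ 2 φ → Continuous fun r => r ^ (n + 1) * deriv φ r ^ 2 :=
    fun h => by
      have := continuous_deriv_of_contDiff_two h
      fun_prop
  have hder : ∀ r ∈ Ioc 0 R, deriv φ₂ r ≤ deriv φ₁ r := by
    intro r hr
    have h := H₁.flux_le_flux H₂ hp hpn hlam₁ hlt hR hc heq ⟨hr.1.le, hr.2⟩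
    rw [flux, flux, neg_le_neg_iff] at h
    exact le_of_mul_le_mul_left h (pow_pos hr.1 _)
  have hsq : ∀ r ∈ Ioc 0 R, deriv φ₁ r ^ 2 ≤ deriv φ₂ r ^ 2 := by
    intro r hr
    have h1 := hder r hr
    have h2 := H₁.deriv_nonpos hr
    nlinarith
  refine intervalIntegral.integral_lt_integral_of_continuousOn_of_le_of_exists_lt hR
    (hcont H₁.contDiff).continuousOn (hcont H₂.contDiff).continuousOn
    (fun r hr => mul_le_mul_of_nonneg_left (hsq r hr) (pow_nonneg hr.1.le _)) ?_
  by_contra! hcon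
  refine H₁.not_deriv_eqOn H₂ hp hlam₁ hlt hR hc heq fun r hr => ?_
  have hr' : r ∈ Ioc 0 R := ⟨hr.1, hr.2.le⟩
  have h1 := le_of_mul_le_mul_left (hcon r ⟨hr.1.le, hr.2.le⟩) (pow_pos hr.1 (n + 1))
  have h2 := hder r hr'
  have h3 := H₁.deriv_nonpos hr'
  nlinarith

end IsRadialProfile

theorem norm_single_one {N : ℕ} (i : Fin N) : ‖EuclideanSpace.single i (1 : ℝ)‖ = 1 := by simp

theorem IsSol.radial {N : ℕ} {R p lam α : ℝ} {ψ : EuclideanSpace ℝ (Fin N) → ℝ} (i : Fin N)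
    (hR : 0 < R) (hp : 1 < p) (hlam : 0 ≤ lam) (h : IsSol (ball 0 R) p lam α ψ)
    {x y : EuclideanSpace ℝ (Fin N)} (hx : ‖x‖ ≤ R) (hxy : ‖x‖ = ‖y‖) : ψ x = ψ y := by
  obtain ⟨hψ, heq, hbd, hint⟩ := h
  rw [frontier_ball _ hR.ne'] at hbd
  obtain ⟨C, hC⟩ := (isCompact_closedBall (0 : EuclideanSpace ℝ (Fin N)) R).bddAbove_image
    (f := fun x => α + lam * ψ x)
    (continuous_const.add (continuous_const.mul hψ.continuous)).continuousOn
  have hC' : ∀ x ∈ closedBall (0 : EuclideanSpace ℝ (Fin N)) R, α + lam * ψ x ≤ max C 0 :=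
    fun x hx => (hC (mem_image_of_mem _ hx)).trans (le_max_left _ _)
  have hne : ∃ z ∈ ball (0 : EuclideanSpace ℝ (Fin N)) R, lapl ψ z ≠ 0 := by
    by_contra! hcon
    have : ∫ x in ball (0 : EuclideanSpace ℝ (Fin N)) R, (max (α + lam * ψ x) 0) ^ p = 0 := by
      refine setIntegral_eq_zero_of_forall_eq_zero fun x hx => ?_
      rw [← heq x hx, hcon x hx, neg_zero]
    linarith
  have hpos := superharmonic_pos_ball hR hψ (norm_single_one i)
    (fun x hx => by linarith [heq x hx, posPart_rpow_nonneg p (α + lam * ψ x)]) hbd hne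
  refine radial_of_positive_solution (f := fun t => max (α + lam * t) 0 ^ p)
    (L := p * max C 0 ^ (p - 1) * lam) hR hψ ?_ ?_ heq hbd hpos hx hxy
  · intro s t hst
    exact monotone_posPart_rpow hp (by gcongr : α + lam * s ≤ α + lam * t)
  · intro x hx y hy
    refine (abs_posPart_rpow_sub_le hp (le_max_right C 0) (hC' x hx) (hC' y hy)).trans ?_
    rw [add_sub_add_left_eq_sub, ← mul_sub, abs_mul, abs_of_nonneg hlam, ← mul_assoc]

theorem deriv_deriv_comp_sqrt {φ : ℝ → ℝ} (hφ : ContDiff ℝ 2 φ) {r : ℝ} (hr : 0 < r) :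
    deriv (deriv fun t => φ √(r ^ 2 + t ^ 2)) 0 = deriv φ r / r := by
  have hg : ∀ t : ℝ, HasDerivAt (fun t => √(r ^ 2 + t ^ 2)) (t / √(r ^ 2 + t ^ 2)) t := by
    intro t
    have h1 : HasDerivAt (fun t : ℝ => r ^ 2 + t ^ 2) (2 * t) t := by
      simpa using (hasDerivAt_pow 2 t).const_add (r ^ 2)
    refine (h1.sqrt (by positivity)).congr_deriv ?_
    field_simp
  have h1 : (deriv fun t => φ √(r ^ 2 + t ^ 2)) =
      fun t => deriv φ √(r ^ 2 + t ^ 2) * (t / √(r ^ 2 + t ^ 2)) :=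
    funext fun t => ((hasDerivAt_of_contDiff_two hφ _).comp t (hg t)).deriv
  have hs : √(r ^ 2 + 0 ^ 2) = r := by simp [Real.sqrt_sq hr.le]
  rw [h1]
  have h2 : HasDerivAt (fun t : ℝ => t / √(r ^ 2 + t ^ 2)) (1 / r) 0 := by
    refine ((hasDerivAt_id (0 : ℝ)).div (hg 0) (by rw [hs]; exact hr.ne')).congr_deriv ?_
    rw [hs]
    simp only [id_eq]
    field_simp
    ring
  refine (((hasDerivAt_deriv_of_contDiff_two hφ _).comp 0 (hg 0)).mul h2).deriv.trans ?_
  simp [Real.sqrt_sq hr.le, div_eq_mul_inv]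

theorem IsSol.isRadialProfile {n : ℕ} {R p lam α : ℝ} {ψ : EuclideanSpace ℝ (Fin (n + 2)) → ℝ}
    (hR : 0 < R) (hp : 1 < p) (hlam : 0 ≤ lam) (h : IsSol (ball 0 R) p lam α ψ) :
    IsRadialProfile n R p lam α fun t => ψ (t • EuclideanSpace.single 0 1) := by
  have hrad := fun {x y} => h.radial (x := x) (y := y) 0 hR hp hlam
  obtain ⟨hψ, heq, -, -⟩ := h
  have hφ : ContDiff ℝ 2 fun t : ℝ => ψ (t • EuclideanSpace.single 0 1) :=
    hψ.comp (contDiff_id.smul contDiff_const)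
  set φ : ℝ → ℝ := fun t => ψ (t • EuclideanSpace.single 0 1) with hφd
  refine ⟨hφ, ?_, fun r hr => ?_⟩
  · have heven : (fun t => φ (-t)) =ᶠ[nhds 0] φ := by
      filter_upwards [Icc_mem_nhds (neg_lt_zero.2 hR) hR] with t ht
      refine hrad ?_ ?_
      · rw [norm_smul, norm_single_one, mul_one, Real.norm_eq_abs, abs_neg]
        exact abs_le.2 ht
      · rw [neg_smul, norm_neg]
    have := heven.deriv_eq
    rw [deriv_comp_neg, neg_zero] at this
    linarith
  · have hrn : ‖r • EuclideanSpace.single (0 : Fin (n + 2)) (1 : ℝ)‖ = r := by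
      rw [norm_smul, norm_single_one, mul_one, Real.norm_of_nonneg hr.1.le]
    have hl := lapl_eq_sum_single hψ (r • EuclideanSpace.single 0 1)
    have he := heq (r • EuclideanSpace.single 0 1) (by rw [mem_ball_zero_iff, hrn]; exact hr.2)
    rw [hl, Fin.sum_univ_succ] at he
    have h0 : deriv (deriv fun t : ℝ => ψ (r • EuclideanSpace.single 0 1 +
        t • EuclideanSpace.single 0 1)) 0 = deriv (deriv φ) r := by
      have e1 : (fun t : ℝ => ψ (r • EuclideanSpace.single 0 1 +
          t • EuclideanSpace.single 0 1)) = fun t => φ (r + t) :=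
        funext fun t => by simp only [hφd, add_smul]
      have e2 : (deriv fun t => φ (r + t)) = fun t => deriv φ (r + t) :=
        funext fun t => deriv_comp_const_add _ _ _
      rw [e1, e2, deriv_comp_const_add, add_zero]
    have hi : ∀ i : Fin (n + 1), deriv (deriv fun t : ℝ => ψ (r • EuclideanSpace.single 0 1 +
        t • EuclideanSpace.single i.succ 1)) 0 = deriv φ r / r := by
      intro i
      rw [← deriv_deriv_comp_sqrt hφ hr.1]
      have hnorm : ∀ t : ℝ, ‖r • EuclideanSpace.single (0 : Fin (n + 2)) (1 : ℝ) +
          t • EuclideanSpace.single i.succ (1 : ℝ)‖ = √(r ^ 2 + t ^ 2) := by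
        intro t
        rw [← Real.sqrt_sq (norm_nonneg (r • EuclideanSpace.single (0 : Fin (n + 2)) (1 : ℝ) +
          t • EuclideanSpace.single i.succ (1 : ℝ))), norm_add_sq_real, hrn, norm_smul,
          norm_single_one, inner_smul_left, inner_smul_right, EuclideanSpace.inner_single_left]
        have hne : (0 : Fin (n + 2)) ≠ i.succ := (Fin.succ_ne_zero i).symm
        simp [hne]
      have hcont : ContinuousAt (fun t : ℝ => √(r ^ 2 + t ^ 2)) 0 := by fun_prop
      have hlt : √(r ^ 2 + 0 ^ 2) < R := by
        simpa [Real.sqrt_sq hr.1.le] using hr.2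
      refine Filter.EventuallyEq.deriv_eq (Filter.EventuallyEq.deriv ?_)
      filter_upwards [hcont.eventually_lt_const hlt] with t ht
      refine hrad ?_ ?_
      · rw [hnorm]
        exact ht.le
      · rw [hnorm, norm_smul, norm_single_one, mul_one, Real.norm_of_nonneg (Real.sqrt_nonneg _)]
    rw [h0, Finset.sum_congr rfl fun i _ => hi i] at he
    simp only [Finset.sum_const, Finset.card_univ, Fintype.card_fin, nsmul_eq_mul] at he
    push_cast at he
    have hr0 := hr.1.ne'
    rw [← he]
    field_simp

theorem setIntegral_ball_fun_norm {n : ℕ} (R : ℝ) (hR : 0 < R) (f : ℝ → ℝ) :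
    ∫ x in ball (0 : EuclideanSpace ℝ (Fin (n + 2))) R, f ‖x‖ =
      (n + 2) * volume.real (ball (0 : EuclideanSpace ℝ (Fin (n + 2))) 1) *
        ∫ r in (0 : ℝ)..R, r ^ (n + 1) * f r := by
  have h1 : ∀ x : EuclideanSpace ℝ (Fin (n + 2)),
      (ball (0 : EuclideanSpace ℝ (Fin (n + 2))) R).indicator (fun x => f ‖x‖) x =
        (Iio R).indicator f ‖x‖ := by
    intro x
    simp only [indicator, mem_ball_zero_iff, mem_Iio]
  have h2 : ∀ y : ℝ, y ^ (n + 1) • (Iio R).indicator f y =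
      (Iio R).indicator (fun y => y ^ (n + 1) * f y) y := by
    intro y
    simp only [indicator, smul_eq_mul, mul_ite, mul_zero]
  rw [← integral_indicator measurableSet_ball, integral_congr_ae (ae_of_all _ h1),
    integral_fun_norm_addHaar, finrank_euclideanSpace_fin, show n + 2 - 1 = n + 1 by omega,
    setIntegral_congr_fun measurableSet_Ioi fun y _ => h2 y,
    setIntegral_indicator measurableSet_Iio, Ioi_inter_Iio, ← integral_Ioc_eq_integral_Ioo,
    ← intervalIntegral.integral_of_le hR.le, nsmul_eq_mul, smul_eq_mul]
  push_cast
  ring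

theorem IsSol.flux_eq {n : ℕ} {R p lam α : ℝ} {ψ : EuclideanSpace ℝ (Fin (n + 2)) → ℝ}
    (hR : 0 < R) (hp : 1 < p) (hlam : 0 ≤ lam) (h : IsSol (ball 0 R) p lam α ψ) :
    (n + 2) * volume.real (ball (0 : EuclideanSpace ℝ (Fin (n + 2))) 1) *
      flux n (fun t => ψ (t • EuclideanSpace.single 0 1)) R = 1 := by
  have H := h.isRadialProfile hR hp hlam
  have hFTC := intervalIntegral.integral_eq_sub_of_hasDerivAt_of_le hR.le
    H.continuous_flux.continuousOn (fun r hr => H.hasDerivAt_flux hr) (by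
      refine Continuous.intervalIntegrable ?_ _ _
      refine (continuous_pow (n + 1)).mul ((continuous_posPart_rpow hp).comp
        (continuous_const.add (continuous_const.mul H.contDiff.continuous))))
  rw [flux_zero, sub_zero] at hFTC
  rw [← hFTC, ← setIntegral_ball_fun_norm R hR
    (fun r => max (α + lam * ψ (r • EuclideanSpace.single 0 1)) 0 ^ p)]
  refine Eq.trans ?_ h.2.2.2
  refine setIntegral_congr_fun measurableSet_ball fun x hx => ?_
  rw [mem_ball_zero_iff] at hx
  have : ψ (‖x‖ • EuclideanSpace.single 0 1) = ψ x := by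
    refine (h.radial 0 hR hp hlam hx.le ?_).symm
    rw [norm_smul, norm_single_one, mul_one, norm_norm]
  simp only [this]

theorem IsSol.integral_norm_gradient_sq {n : ℕ} {R p lam α : ℝ}
    {ψ : EuclideanSpace ℝ (Fin (n + 2)) → ℝ}
    (hR : 0 < R) (hp : 1 < p) (hlam : 0 ≤ lam) (h : IsSol (ball 0 R) p lam α ψ) :
    ∫ x in ball 0 R, ‖gradient ψ x‖ ^ 2 =
      (n + 2) * volume.real (ball (0 : EuclideanSpace ℝ (Fin (n + 2))) 1) *
        ∫ r in (0 : ℝ)..R,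
          r ^ (n + 1) * deriv (fun t => ψ (t • EuclideanSpace.single 0 1)) r ^ 2 := by
  have H := h.isRadialProfile hR hp hlam
  rw [← setIntegral_ball_fun_norm R hR
    (fun r => deriv (fun t => ψ (t • EuclideanSpace.single 0 1)) r ^ 2)]
  refine integral_congr_ae ?_
  have hne : ∀ᵐ x : EuclideanSpace ℝ (Fin (n + 2)), x ≠ 0 := by
    simp [ae_iff]
  filter_upwards [ae_restrict_mem measurableSet_ball, ae_restrict_of_ae hne] with x hx hx0
  have hnorm : DifferentiableAt ℝ (fun y : EuclideanSpace ℝ (Fin (n + 2)) => ‖y‖) x :=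
    (contDiffAt_norm ℝ hx0 (n := 1)).differentiableAt one_ne_zero
  have hloc : ψ =ᶠ[nhds x] fun y => (fun t : ℝ => ψ (t • EuclideanSpace.single 0 1)) ‖y‖ := by
    filter_upwards [isOpen_ball.mem_nhds hx] with y hy
    rw [mem_ball_zero_iff] at hy
    refine h.radial 0 hR hp hlam hy.le ?_
    rw [norm_smul, norm_single_one, mul_one, norm_norm]
  have hfd : fderiv ℝ ψ x = deriv (fun t : ℝ => ψ (t • EuclideanSpace.single 0 1)) ‖x‖ •
      fderiv ℝ (fun y : EuclideanSpace ℝ (Fin (n + 2)) => ‖y‖) x := by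
    rw [hloc.fderiv_eq]
    exact ((hasDerivAt_of_contDiff_two H.contDiff ‖x‖).comp_hasFDerivAt x
      hnorm.hasFDerivAt).fderiv
  rw [gradient, LinearIsometryEquiv.norm_map, hfd, norm_smul, norm_fderiv_norm hnorm, mul_one,
    Real.norm_eq_abs, sq_abs]

theorem RN_pos (n : ℕ) : 0 < RN (n + 2) := by
  refine Real.rpow_pos_of_pos (ENNReal.toReal_pos ?_ measure_ball_lt_top.ne) _
  exact (measure_ball_pos volume 0 one_pos).ne'

theorem stmt3 (N : ℕ) (hN : 2 ≤ N) (p : ℝ) (hp1 : 1 < p)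
    (hpN : N = 2 ∨ p < (N : ℝ) / ((N : ℝ) - 2))
    (lam₁ lam₂ : ℝ) (hlam₁ : 0 ≤ lam₁) (hlt : lam₁ < lam₂)
    (α₁ α₂ : ℝ) (ψ₁ ψ₂ : EuclideanSpace ℝ (Fin N) → ℝ)
    (hsol₁ : IsSol (DN N) p lam₁ α₁ ψ₁) (hsol₂ : IsSol (DN N) p lam₂ α₂ ψ₂) :
    (∫ x in DN N, ‖gradient ψ₁ x‖ ^ 2) < ∫ x in DN N, ‖gradient ψ₂ x‖ ^ 2 := by
  obtain ⟨n, rfl⟩ : ∃ n, N = n + 2 := ⟨N - 2, by omega⟩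
  have hpn : p * n < n + 2 := by
    rcases Nat.eq_zero_or_pos n with h0 | h0
    · subst h0
      norm_num
    · have hn : (0 : ℝ) < n := by exact_mod_cast h0
      have h := hpN.resolve_left (by omega)
      push_cast at h
      rwa [add_sub_cancel_right, lt_div_iff₀ hn] at h
  have hR := RN_pos n
  have hlam₂ := hlam₁.trans hlt.le
  unfold DN at hsol₁ hsol₂ ⊢
  have hω : 0 < volume.real (ball (0 : EuclideanSpace ℝ (Fin (n + 2))) 1) :=
    ENNReal.toReal_pos (measure_ball_pos volume 0 one_pos).ne' measure_ball_lt_top.ne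
  have hA : 0 < ((n : ℝ) + 2) * volume.real (ball (0 : EuclideanSpace ℝ (Fin (n + 2))) 1) := by
    positivity
  have hm₁ := hsol₁.flux_eq hR hp1 hlam₁
  have hm₂ := hsol₂.flux_eq hR hp1 hlam₂
  rw [hsol₁.integral_norm_gradient_sq hR hp1 hlam₁, hsol₂.integral_norm_gradient_sq hR hp1 hlam₂]
  refine mul_lt_mul_of_pos_left ?_ hA
  refine (hsol₁.isRadialProfile hR hp1 hlam₁).energy_lt (hsol₂.isRadialProfile hR hp1 hlam₂) hp1 hpn
    hlam₁ hlt hR ?_ (mul_left_cancel₀ hA.ne' (hm₁.trans hm₂.symm))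
  exact pos_of_mul_pos_right (by rw [hm₁]; exact one_pos) hA.le

end
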